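/- arXiv:2507.04016 — 5 statements merged into one kernel-verified Lean document; each statement's English description precedes it below -/
import Mathlib

section
/- Define X(m,d) for integers m,d ≥ 1 by X(m,d) = 1 if m = 1 or d = 1, and X(m,d) = X(m−1,d)·((m−1)·X(m,d−1) + 1) + X(m,d−1) otherwise; and define Y(m,d) for integers m,d ≥ 1 by Y(1,d) = 1, Y(m,1) = X(m,m) for m ≥ 2, and Y(m,d) = m²·(Y(m−1,d)^m + 1)·(Y(m,d−1) + 1) + m·Y(m−1,d)^{m+1} + 1 for m,d ≥ 2. Then for all integers m,d ≥ 1 and every deterministic online algorithm A for OMHC(m), there exists a hyperforest instance H with at most Y(m,d) nodes such that A's coloring φ of H satisfies at least one of: (i) there exist hyperedges e_1,…,e_m of H, each of size d, lying in pairwise distinct connected components of H, such that all nodes of e_i have color i under φ; or (ii) some hyperedge e ∈ E with |e| = m is monochromatic under φ. -/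
open Finset

/-- An instance of Online Makespan Hypergraph Coloring: a hypergraph on nodes `{1,…,n}`. -/
structure OMHCInstance where
  n : ℕ
  E : Finset (Finset ℕ)
  hE : ∀ e ∈ E, e ⊆ Finset.Icc 1 n

/-- A deterministic online algorithm for `OMHC(m)`: the color of node `j` is a function
only of `j` and the partial hyperedges `e ∩ [j]`. -/
abbrev OMHCAlg (m : ℕ) := ℕ → Finset (Finset ℕ) → Fin m

/-- The coloring produced by online algorithm `A` on instance `I`. -/
def omhcAssign {m : ℕ} (A : OMHCAlg m) (I : OMHCInstance) : ℕ → Fin m :=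
  fun j => A j (I.E.image (fun e => e ∩ Finset.Icc 1 j))

/-- Makespan of a coloring: `max_{e ∈ E} max_{i ∈ [m]} |e ∩ φ⁻¹(i)|`. -/
def omhcMakespan (m : ℕ) (I : OMHCInstance) (φ : ℕ → Fin m) : ℕ :=
  I.E.sup (fun e => Finset.univ.sup (fun i : Fin m => (e.filter (fun v => φ v = i)).card))

/-- Offline optimum of an `OMHC(m)` instance: the minimum makespan over all colorings. -/
noncomputable def omhcOPT (m : ℕ) (I : OMHCInstance) : ℕ :=
  sInf {v | ∃ φ : ℕ → Fin m, v = omhcMakespan m I φ}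

/-- A hyperforest is a hypergraph without a hypercycle, i.e. without a cyclic sequence
`v_1, e_1, v_2, …, e_ℓ, v_{ℓ+1} = v_1` of pairwise distinct hyperedges `e_t` with
`v_t, v_{t+1} ∈ e_t` (consecutive nodes being distinct). -/
def IsHyperforest (E : Finset (Finset ℕ)) : Prop :=
  ¬ ∃ (l : ℕ) (v : ℕ → ℕ) (e : ℕ → Finset ℕ),
      1 ≤ l ∧
      (∀ t < l, e t ∈ E) ∧
      (∀ s < l, ∀ t < l, s ≠ t → e s ≠ e t) ∧
      (∀ t < l, v t ∈ e t ∧ v ((t + 1) % l) ∈ e t ∧ v t ≠ v ((t + 1) % l))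

/-- The recursion `X(m,d)` from Lemma 4.1: `X(m,d) = 1` if `m = 1` or `d = 1`, and
`X(m,d) = X(m-1,d)·((m-1)·X(m,d-1) + 1) + X(m,d-1)` otherwise. -/
def Xrec : ℕ → ℕ → ℕ
  | 0, _ => 1
  | _, 0 => 1
  | 1, _ => 1
  | _, 1 => 1
  | m + 2, d + 2 =>
      Xrec (m + 1) (d + 2) * ((m + 1) * Xrec (m + 2) (d + 1) + 1) + Xrec (m + 2) (d + 1)
  termination_by m d => (m, d)

/-- The recursion `Y(m,d)` from Lemma 4.3: `Y(1,d) = 1`, `Y(m,1) = X(m,m)` for `m ≥ 2`, and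
`Y(m,d) = m²·(Y(m-1,d)^m + 1)·(Y(m,d-1) + 1) + m·Y(m-1,d)^(m+1) + 1` for `m, d ≥ 2`. -/
def Yrec : ℕ → ℕ → ℕ
  | 0, _ => 1
  | 1, _ => 1
  | m + 2, 0 => Xrec (m + 2) (m + 2)
  | m + 2, 1 => Xrec (m + 2) (m + 2)
  | m + 2, d + 2 =>
      (m + 2) ^ 2 * (Yrec (m + 1) (d + 2) ^ (m + 2) + 1) * (Yrec (m + 2) (d + 1) + 1)
        + (m + 2) * Yrec (m + 1) (d + 2) ^ (m + 3) + 1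
  termination_by m d => (m, d)

/-- Two nodes of a hypergraph are connected if they are joined by a walk of hyperedges. -/
def HConnected (E : Finset (Finset ℕ)) (u w : ℕ) : Prop :=
  ∃ (l : ℕ) (v : ℕ → ℕ) (e : ℕ → Finset ℕ),
    v 0 = u ∧ v l = w ∧ ∀ t < l, e t ∈ E ∧ v t ∈ e t ∧ v (t + 1) ∈ e t

/-- The color given to node `j` by an online algorithm with colors in `ℕ` on the edge set `E`. -/
def onlineColor (A : ℕ → Finset (Finset ℕ) → ℕ) (E : Finset (Finset ℕ)) (j : ℕ) : ℕ :=
  A j (E.image (fun e => e ∩ Finset.Icc 1 j))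

/-- The spaces of zero-sum functions supported on the single hyperedges are independent.
This is an algebraic form of the absence of hypercycles. -/
def ZeroSumIndep (E : Finset (Finset ℕ)) : Prop :=
  ∀ g : Finset ℕ → ℕ → ℤ, (∀ e ∈ E, ∀ v, v ∉ e → g e v = 0) →
    (∀ e ∈ E, ∑ v ∈ e, g e v = 0) → (∀ v, ∑ e ∈ E, g e v = 0) → ∀ e ∈ E, ∀ v, g e v = 0

/-- `L` is constant on every hyperedge, hence on every connected component. -/
def IsLabeling (E : Finset (Finset ℕ)) (L : ℕ → ℕ) : Prop :=
  ∀ e ∈ E, ∀ u ∈ e, ∀ w ∈ e, L u = L w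

theorem IsLabeling.eq_of_hconnected {E : Finset (Finset ℕ)} {L : ℕ → ℕ} (hL : IsLabeling E L)
    {u w : ℕ} (h : HConnected E u w) : L u = L w := by
  obtain ⟨l, v, e, rfl, rfl, h⟩ := h
  have key : ∀ t, t ≤ l → L (v 0) = L (v t) := by
    intro t
    induction t with
    | zero => intro _; rfl
    | succ t ih =>
      intro ht
      obtain ⟨h1, h2, h3⟩ := h t (by omega)
      exact (ih (by omega)).trans (hL _ h1 _ h2 _ h3)
  exact key l le_rfl

/-- Adding hyperedges with at most one node to an independent family yields a hyperforest. -/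
theorem ZeroSumIndep.isHyperforest {E E' : Finset (Finset ℕ)} (hE : ZeroSumIndep E)
    (h : ∀ e ∈ E', ∀ u ∈ e, ∀ w ∈ e, u ≠ w → e ∈ E) : IsHyperforest E' := by
  classical
  rintro ⟨l, v, e, hl, he, hne, hv⟩
  have heE : ∀ t < l, e t ∈ E := fun t ht =>
    h _ (he t ht) _ (hv t ht).1 _ (hv t ht).2.1 (hv t ht).2.2
  let δ : ℕ → ℕ → ℤ := fun a x => if x = a then 1 else 0
  let g : Finset ℕ → ℕ → ℤ := fun f x =>
    ∑ t ∈ Finset.range l, if e t = f then δ (v t) x - δ (v ((t + 1) % l)) x else 0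
  have hsum : ∀ f : Finset ℕ, ∀ a ∈ f, ∑ x ∈ f, δ a x = 1 := by
    intro f a ha
    simp [δ, ha]
  have hδ : ∀ a x : ℕ, x ≠ a → δ a x = 0 := fun a x hx => by simp [δ, hx]
  have hz := hE g ?_ ?_ ?_ (e 0) (heE 0 (by omega)) (v 0)
  · have : g (e 0) (v 0) = δ (v 0) (v 0) - δ (v ((0 + 1) % l)) (v 0) := by
      simp only [g]
      rw [Finset.sum_eq_single 0]
      · simp
      · intro t ht ht0
        rw [if_neg]
        exact hne t (Finset.mem_range.1 ht) 0 (by omega) ht0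
      · intro h0
        exact absurd (Finset.mem_range.2 (by omega)) h0
    rw [this, hδ _ _ (hv 0 (by omega)).2.2] at hz
    simp [δ] at hz
  · intro f _ x hx
    refine Finset.sum_eq_zero fun t ht => ?_
    split_ifs with hf
    · subst hf
      have := hv t (Finset.mem_range.1 ht)
      rw [hδ _ _ (ne_of_mem_of_not_mem this.1 hx).symm,
        hδ _ _ (ne_of_mem_of_not_mem this.2.1 hx).symm, sub_zero]
    · rfl
  · intro f _
    simp only [g]
    rw [Finset.sum_comm]
    refine Finset.sum_eq_zero fun t ht => ?_
    split_ifs with hf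
    · subst hf
      have := hv t (Finset.mem_range.1 ht)
      rw [Finset.sum_sub_distrib, hsum _ _ this.1, hsum _ _ this.2.1, sub_self]
    · simp
  · intro x
    simp only [g]
    rw [Finset.sum_comm]
    have h1 : ∀ t ∈ Finset.range l,
        (∑ f ∈ E, if e t = f then δ (v t) x - δ (v ((t + 1) % l)) x else 0)
          = δ (v t) x - δ (v ((t + 1) % l)) x := by
      intro t ht
      rw [Finset.sum_ite_eq, if_pos (heE t (Finset.mem_range.1 ht))]
    rw [Finset.sum_congr rfl h1, Finset.sum_sub_distrib]
    obtain ⟨k, rfl⟩ : ∃ k, l = k + 1 := ⟨l - 1, by omega⟩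
    rw [Finset.sum_range_succ' (fun t => δ (v t) x),
      Finset.sum_range_succ (fun t => δ (v ((t + 1) % (k + 1))) x)]
    have h2 : ∀ t ∈ Finset.range k, δ (v ((t + 1) % (k + 1))) x = δ (v (t + 1)) x := by
      intro t ht
      rw [Nat.mod_eq_of_lt (by have := Finset.mem_range.1 ht; omega)]
    rw [Finset.sum_congr rfl h2, Nat.mod_self, sub_self]

/-- The hyperedge `e`, extended by the node `n + att e` if `1 ≤ att e ≤ k`. -/
def extendEdge (n k : ℕ) (att : Finset ℕ → ℕ) (e : Finset ℕ) : Finset ℕ :=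
  if 1 ≤ att e ∧ att e ≤ k then insert (n + att e) e else e

/-- The hyperedge `e` translated by `n`. -/
def shiftEdge (n : ℕ) (e : Finset ℕ) : Finset ℕ := e.image (fun v => n + v)

/-- The hyperedges `E` on nodes `1, …, n` followed by a copy of the hyperedges `E'` on nodes
`n + 1, …, n + k`, where each `e ∈ E` with `1 ≤ att e ≤ k` is extended by the node `n + att e`. -/
def composeEdges (n k : ℕ) (att : Finset ℕ → ℕ) (E E' : Finset (Finset ℕ)) :
    Finset (Finset ℕ) :=
  E.image (extendEdge n k att) ∪ E'.image (shiftEdge n)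

/-- The online algorithm which `A` induces on the nodes that follow the hyperedges `E` on
`1, …, n`, when these are being extended according to `att`. -/
def inducedAlg (A : ℕ → Finset (Finset ℕ) → ℕ) (n : ℕ) (att : Finset ℕ → ℕ)
    (E : Finset (Finset ℕ)) : ℕ → Finset (Finset ℕ) → ℕ :=
  fun j E' => A (n + j) (composeEdges n j att E E')

theorem mem_extendEdge {n k : ℕ} {att : Finset ℕ → ℕ} {e : Finset ℕ} {v : ℕ} :
    v ∈ extendEdge n k att e ↔ v ∈ e ∨ (1 ≤ att e ∧ att e ≤ k ∧ v = n + att e) := by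
  unfold extendEdge
  split_ifs with h
  · rw [Finset.mem_insert]; tauto
  · tauto

theorem mem_shiftEdge {n : ℕ} {e : Finset ℕ} {v : ℕ} :
    v ∈ shiftEdge n e ↔ ∃ u ∈ e, n + u = v := by
  simp [shiftEdge]

theorem shiftEdge_injective (n : ℕ) : Function.Injective (shiftEdge n) :=
  Finset.image_injective (fun _ _ h => Nat.add_left_cancel h)

theorem subset_Icc_of_mem_composeEdges {n k : ℕ} {att : Finset ℕ → ℕ}
    {E E' : Finset (Finset ℕ)} (hE : ∀ e ∈ E, e ⊆ Finset.Icc 1 n)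
    (hE' : ∀ e ∈ E', e ⊆ Finset.Icc 1 k) :
    ∀ e ∈ composeEdges n k att E E', e ⊆ Finset.Icc 1 (n + k) := by
  intro f hf v hv
  rw [Finset.mem_Icc]
  rcases Finset.mem_union.1 hf with hf | hf
  · obtain ⟨e, he, rfl⟩ := Finset.mem_image.1 hf
    rcases mem_extendEdge.1 hv with h | h
    · have := Finset.mem_Icc.1 (hE e he h); omega
    · omega
  · obtain ⟨e, he, rfl⟩ := Finset.mem_image.1 hf
    obtain ⟨u, hu, rfl⟩ := mem_shiftEdge.1 hv
    have := Finset.mem_Icc.1 (hE' e he hu); omega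

theorem onlineColor_composeEdges_left (A : ℕ → Finset (Finset ℕ) → ℕ) {n k : ℕ}
    {att : Finset ℕ → ℕ} {E E' : Finset (Finset ℕ)} (h0 : ∅ ∈ E) {j : ℕ} (hj : j ≤ n)
    (hE' : ∀ e ∈ E', e ⊆ Finset.Icc 1 k) :
    onlineColor A (composeEdges n k att E E') j = onlineColor A E j := by
  unfold onlineColor
  congr 1
  have hext : ∀ e : Finset ℕ, extendEdge n k att e ∩ Finset.Icc 1 j = e ∩ Finset.Icc 1 j := by
    intro e
    ext v
    rw [Finset.mem_inter, Finset.mem_inter, mem_extendEdge, Finset.mem_Icc]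
    constructor
    · rintro ⟨h | h, h'⟩
      · exact ⟨h, h'⟩
      · omega
    · rintro ⟨h, h'⟩
      exact ⟨Or.inl h, h'⟩
  rw [composeEdges, Finset.image_union, Finset.image_image, Finset.image_image]
  have h1 : E.image ((fun e => e ∩ Finset.Icc 1 j) ∘ extendEdge n k att)
      = E.image (fun e => e ∩ Finset.Icc 1 j) :=
    Finset.image_congr fun e _ => hext e
  rw [h1, Finset.union_eq_left]
  intro f hf
  obtain ⟨e, he, rfl⟩ := Finset.mem_image.1 hf
  refine Finset.mem_image.2 ⟨∅, h0, ?_⟩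
  simp only [Function.comp, Finset.empty_inter]
  symm
  rw [Finset.eq_empty_iff_forall_notMem]
  intro v hv
  rw [Finset.mem_inter, mem_shiftEdge, Finset.mem_Icc] at hv
  obtain ⟨⟨u, hu, rfl⟩, h⟩ := hv
  have := Finset.mem_Icc.1 (hE' e he hu)
  omega

theorem onlineColor_composeEdges_right (A : ℕ → Finset (Finset ℕ) → ℕ) {n k : ℕ}
    {att : Finset ℕ → ℕ} {E E' : Finset (Finset ℕ)} (hE : ∀ e ∈ E, e ⊆ Finset.Icc 1 n)
    {j : ℕ} (hj : j ≤ k) (hE' : ∀ e ∈ E', e ⊆ Finset.Icc 1 k) :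
    onlineColor A (composeEdges n k att E E') (n + j)
      = onlineColor (inducedAlg A n att E) E' j := by
  unfold onlineColor inducedAlg composeEdges
  congr 1
  rw [Finset.image_union, Finset.image_image, Finset.image_image, Finset.image_image]
  congr 1
  · refine Finset.image_congr fun e he => ?_
    ext v
    simp only [Function.comp, Finset.mem_inter, mem_extendEdge, Finset.mem_Icc]
    constructor
    · rintro ⟨h | h, h'⟩
      · exact Or.inl h
      · right; omega
    · rintro (h | h)
      · have := Finset.mem_Icc.1 (hE e he h)
        exact ⟨Or.inl h, by omega⟩
      · exact ⟨Or.inr (by omega), by omega⟩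
  · refine Finset.image_congr fun e he => ?_
    ext v
    simp only [Function.comp, Finset.mem_inter, mem_shiftEdge, Finset.mem_Icc]
    constructor
    · rintro ⟨⟨u, hu, rfl⟩, h'⟩
      have := Finset.mem_Icc.1 (hE' e he hu)
      exact ⟨u, ⟨hu, by omega⟩, rfl⟩
    · rintro ⟨u, ⟨hu, h⟩, rfl⟩
      exact ⟨⟨u, hu, rfl⟩, by omega⟩

theorem ZeroSumIndep.composeEdges {n k : ℕ} {att : Finset ℕ → ℕ} {lam : ℕ → ℕ}
    {E E' : Finset (Finset ℕ)} (hE : ∀ e ∈ E, e ⊆ Finset.Icc 1 n)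
    (hE' : ∀ e ∈ E', e ⊆ Finset.Icc 1 k) (hI : ZeroSumIndep E) (hI' : ZeroSumIndep E')
    (hlam : IsLabeling E lam)
    (hatt : ∀ e ∈ E, 1 ≤ att e → e.Nonempty ∧ ∀ u ∈ e, lam u = att e)
    (hinj : ∀ e ∈ E, ∀ f ∈ E, 1 ≤ att e → att e = att f → e = f) :
    ZeroSumIndep (composeEdges n k att E E') := by
  intro g hsupp hzero hsum
  have hmemE : ∀ e ∈ E, extendEdge n k att e ∈ _root_.composeEdges n k att E E' := fun e he =>
    Finset.mem_union_left _ (Finset.mem_image_of_mem _ he)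
  have hmemE' : ∀ e ∈ E', shiftEdge n e ∈ _root_.composeEdges n k att E E' := fun e he =>
    Finset.mem_union_right _ (Finset.mem_image_of_mem _ he)
  have hle : ∀ e ∈ E, ∀ v, v ≤ n → v ∈ extendEdge n k att e → v ∈ e := by
    intro e _ v hv h
    rcases mem_extendEdge.1 h with h | h
    · exact h
    · omega
  have hextinj : Set.InjOn (extendEdge n k att) (E : Set (Finset ℕ)) := by
    intro e he f hf hef
    ext v
    constructor
    · intro hv
      have := Finset.mem_Icc.1 (hE e he hv)
      exact hle f hf v this.2 (hef ▸ mem_extendEdge.2 (Or.inl hv))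
    · intro hv
      have := Finset.mem_Icc.1 (hE f hf hv)
      exact hle e he v this.2 (hef ▸ mem_extendEdge.2 (Or.inl hv))
  have hleft : ∀ v, v ≤ n → ∑ e ∈ E, g (extendEdge n k att e) v = 0 := by
    intro v hv
    rw [← hsum v, ← Finset.sum_image (f := fun e => g e v) hextinj]
    refine Finset.sum_subset Finset.subset_union_left fun f hf hf' => ?_
    refine hsupp f hf v fun hvf => ?_
    rcases Finset.mem_union.1 hf with h | h
    · exact hf' h
    · obtain ⟨e, he, rfl⟩ := Finset.mem_image.1 h
      obtain ⟨u, hu, rfl⟩ := mem_shiftEdge.1 hvf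
      have := Finset.mem_Icc.1 (hE' e he hu)
      omega
  have hattach : ∀ e ∈ E, 1 ≤ att e → att e ≤ k → g (extendEdge n k att e) (n + att e) = 0 := by
    intro e he h1 h2
    have hB : ∑ f ∈ E, ∑ v ∈ (Finset.Icc 1 n).filter (fun v => lam v = att e),
        g (extendEdge n k att f) v = 0 := by
      rw [Finset.sum_comm]
      exact Finset.sum_eq_zero fun v hv =>
        hleft v (Finset.mem_Icc.1 (Finset.mem_filter.1 hv).1).2
    have hfull : ∀ f ∈ E, (∃ w ∈ f, lam w = att e) →
        ∑ v ∈ (Finset.Icc 1 n).filter (fun v => lam v = att e), g (extendEdge n k att f) v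
          = ∑ v ∈ f, g (extendEdge n k att f) v := by
      rintro f hf ⟨w, hw, hwt⟩
      symm
      refine Finset.sum_subset (fun v hv => Finset.mem_filter.2
        ⟨hE f hf hv, (hlam f hf v hv w hw).trans hwt⟩) fun v hv hvf => ?_
      exact hsupp _ (hmemE f hf) v fun h =>
        hvf (hle f hf v (Finset.mem_Icc.1 (Finset.mem_filter.1 hv).1).2 h)
    rw [Finset.sum_eq_single e] at hB
    · obtain ⟨⟨w, hw⟩, hl⟩ := hatt e he h1
      rw [hfull e he ⟨w, hw, hl w hw⟩] at hB
      have hz := hzero _ (hmemE e he)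
      have hins : extendEdge n k att e = insert (n + att e) e := if_pos ⟨h1, h2⟩
      have hnot : n + att e ∉ e := fun h => by
        have := Finset.mem_Icc.1 (hE e he h); omega
      rw [hins, Finset.sum_insert hnot, ← hins, hB, add_zero] at hz
      exact hz
    · intro f hf hfe
      by_cases hex : ∃ w ∈ f, lam w = att e
      · rw [hfull f hf hex]
        have h0 : ¬ (1 ≤ att f ∧ att f ≤ k) := by
          rintro ⟨h3, -⟩
          obtain ⟨w, hw, hwt⟩ := hex
          exact hfe (hinj f hf e he h3 (((hatt f hf h3).2 w hw).symm.trans hwt))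
        have hz := hzero _ (hmemE f hf)
        have hext : extendEdge n k att f = f := if_neg h0
        rw [hext] at hz ⊢
        exact hz
      · refine Finset.sum_eq_zero fun v hv => hsupp _ (hmemE f hf) v fun h => hex ?_
        obtain ⟨hv1, hv2⟩ := Finset.mem_filter.1 hv
        exact ⟨v, hle f hf v (Finset.mem_Icc.1 hv1).2 h, hv2⟩
    · exact fun h => absurd he h
  have hnew : ∀ e ∈ E, ∀ v, v ∉ e → g (extendEdge n k att e) v = 0 := by
    intro e he v hv
    by_cases h : v ∈ extendEdge n k att e
    · rcases mem_extendEdge.1 h with h | ⟨h1, h2, rfl⟩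
      · exact absurd h hv
      · exact hattach e he h1 h2
    · exact hsupp _ (hmemE e he) v h
  have hEz : ∀ e ∈ E, ∀ v, g (extendEdge n k att e) v = 0 := by
    refine hI (fun e v => g (extendEdge n k att e) v) hnew ?_ ?_
    · intro e he
      rw [← hzero _ (hmemE e he)]
      exact Finset.sum_subset (fun v hv => mem_extendEdge.2 (Or.inl hv))
        fun v _ hv => hnew e he v hv
    · intro v
      by_cases hv : v ≤ n
      · exact hleft v hv
      · exact Finset.sum_eq_zero fun e he => hnew e he v fun h =>
          hv (Finset.mem_Icc.1 (hE e he h)).2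
  have hE'z : ∀ e ∈ E', ∀ v, g (shiftEdge n e) (n + v) = 0 := by
    refine hI' (fun e v => g (shiftEdge n e) (n + v)) ?_ ?_ ?_
    · intro e he v hv
      refine hsupp _ (hmemE' e he) _ fun h => hv ?_
      obtain ⟨u, hu, huv⟩ := mem_shiftEdge.1 h
      rwa [← Nat.add_left_cancel huv]
    · intro e he
      rw [← hzero _ (hmemE' e he)]
      conv_rhs => rw [shiftEdge]
      rw [Finset.sum_image (fun _ _ _ _ h => Nat.add_left_cancel h)]
      rfl
    · intro v
      rw [← hsum (n + v),
        ← Finset.sum_image (f := fun e => g e (n + v)) (shiftEdge_injective n).injOn]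
      refine Finset.sum_subset Finset.subset_union_right fun f hf hf' => ?_
      rcases Finset.mem_union.1 hf with h | h
      · obtain ⟨e, he, rfl⟩ := Finset.mem_image.1 h
        exact hEz e he _
      · exact absurd h hf'
  intro f hf v
  rcases Finset.mem_union.1 hf with h | h
  · obtain ⟨e, he, rfl⟩ := Finset.mem_image.1 h
    exact hEz e he v
  · obtain ⟨e, he, rfl⟩ := Finset.mem_image.1 h
    by_cases hv : v ∈ shiftEdge n e
    · obtain ⟨u, -, rfl⟩ := mem_shiftEdge.1 hv
      exact hE'z e he u
    · exact hsupp _ hf v hv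

/-- Labelings of the two parts of a composition, which agree along the extended hyperedges,
label the composition. -/
theorem IsLabeling.composeEdges {n k : ℕ} {att : Finset ℕ → ℕ} {E E' : Finset (Finset ℕ)}
    (hE : ∀ e ∈ E, e ⊆ Finset.Icc 1 n) (hE' : ∀ e ∈ E', e ⊆ Finset.Icc 1 k) {L L' : ℕ → ℕ}
    (hL : IsLabeling E L) (hL' : IsLabeling E' L')
    (h : ∀ e ∈ E, 1 ≤ att e → att e ≤ k → ∀ u ∈ e, L u = L' (att e)) :
    IsLabeling (composeEdges n k att E E') (fun v => if v ≤ n then L v else L' (v - n)) := by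
  have hleft : ∀ e ∈ E, ∀ u ∈ e, (if u ≤ n then L u else L' (u - n)) = L u := fun e he u hu =>
    if_pos (Finset.mem_Icc.1 (hE e he hu)).2
  have hright : ∀ t, 1 ≤ t → (if n + t ≤ n then L (n + t) else L' (n + t - n)) = L' t := by
    intro t ht
    rw [if_neg (by omega), Nat.add_sub_cancel_left]
  intro f hf u hu w hw
  beta_reduce
  rcases Finset.mem_union.1 hf with hf | hf
  · obtain ⟨e, he, rfl⟩ := Finset.mem_image.1 hf
    rcases mem_extendEdge.1 hu with hu | ⟨h1, h2, rfl⟩ <;>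
      rcases mem_extendEdge.1 hw with hw | ⟨h3, h4, rfl⟩
    · rw [hleft e he u hu, hleft e he w hw]
      exact hL e he u hu w hw
    · rw [hleft e he u hu, hright _ h3]
      exact h e he h3 h4 u hu
    · rw [hleft e he w hw, hright _ h1]
      exact (h e he h1 h2 w hw).symm
    · rfl
  · obtain ⟨e, he, rfl⟩ := Finset.mem_image.1 hf
    obtain ⟨a, ha, rfl⟩ := mem_shiftEdge.1 hu
    obtain ⟨b, hb, rfl⟩ := mem_shiftEdge.1 hw
    rw [hright _ (Finset.mem_Icc.1 (hE' e he ha)).1, hright _ (Finset.mem_Icc.1 (hE' e he hb)).1]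
    exact hL' e he a ha b hb

/-- A hyperforest on the nodes `1, …, n` with the empty hyperedge, whose presence hides from an
online algorithm whether there are hyperedges without revealed nodes, and with a labeling. -/
structure IsLabeledForest (n : ℕ) (E : Finset (Finset ℕ)) (L : ℕ → ℕ) : Prop where
  subset_Icc : ∀ e ∈ E, e ⊆ Finset.Icc 1 n
  empty_mem : ∅ ∈ E
  indep : ZeroSumIndep E
  labeling : IsLabeling E L

/-- The colors in `C` occur on nodes with pairwise distinct labels. -/
def IsRainbow (A : ℕ → Finset (Finset ℕ) → ℕ) (C : Finset ℕ) (n : ℕ) (E : Finset (Finset ℕ))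
    (L : ℕ → ℕ) : Prop :=
  ∃ f : ℕ → ℕ, (∀ c ∈ C, f c ∈ Finset.Icc 1 n ∧ onlineColor A E (f c) = c) ∧
    ∀ c ∈ C, ∀ c' ∈ C, L (f c) = L (f c') → c = c'

/-- Some hyperedge of size `d` is monochromatic. -/
def HasMono (A : ℕ → Finset (Finset ℕ) → ℕ) (d : ℕ) (E : Finset (Finset ℕ)) : Prop :=
  ∃ e ∈ E, e.card = d ∧ ∃ c, ∀ v ∈ e, onlineColor A E v = c

theorem zeroSumIndep_of_card_le_one {E : Finset (Finset ℕ)} (h : ∀ e ∈ E, e.card ≤ 1) :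
    ZeroSumIndep E := by
  intro g hsupp hzero _ e he v
  by_cases hv : v ∈ e
  · have he' : e = {v} := by
      refine (Finset.eq_of_subset_of_card_le (Finset.singleton_subset_iff.2 hv) ?_).symm
      simpa using h e he
    have := hzero e he
    rw [he', Finset.sum_singleton] at this
    rw [he', this]
  · exact hsupp e he v hv

theorem isLabeledForest_singleton : IsLabeledForest 1 {∅, {1}} (fun _ => 0) where
  subset_Icc := by decide
  empty_mem := by decide
  indep := zeroSumIndep_of_card_le_one (by decide)
  labeling := fun _ _ _ _ _ _ => rfl

theorem isLabeledForest_empty : IsLabeledForest 0 {∅} (fun _ => 0) where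
  subset_Icc := by decide
  empty_mem := by decide
  indep := zeroSumIndep_of_card_le_one (by decide)
  labeling := fun _ _ _ _ _ _ => rfl

theorem IsLabeledForest.composeEdges {n k : ℕ} {att : Finset ℕ → ℕ} {lam : ℕ → ℕ}
    {E E' : Finset (Finset ℕ)} {L₀ L₀' L L' : ℕ → ℕ} (hE : IsLabeledForest n E L₀)
    (hE' : IsLabeledForest k E' L₀') (hlam : IsLabeling E lam)
    (hatt : ∀ e ∈ E, 1 ≤ att e → e.Nonempty ∧ ∀ u ∈ e, lam u = att e)
    (hinj : ∀ e ∈ E, ∀ f ∈ E, 1 ≤ att e → att e = att f → e = f)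
    (hL : IsLabeling E L) (hL' : IsLabeling E' L')
    (h : ∀ e ∈ E, 1 ≤ att e → att e ≤ k → ∀ u ∈ e, L u = L' (att e)) :
    IsLabeledForest (n + k) (composeEdges n k att E E')
      (fun v => if v ≤ n then L v else L' (v - n)) where
  subset_Icc := subset_Icc_of_mem_composeEdges hE.subset_Icc hE'.subset_Icc
  empty_mem := Finset.mem_union_right _ (Finset.mem_image.2 ⟨∅, hE'.empty_mem, rfl⟩)
  indep := ZeroSumIndep.composeEdges hE.subset_Icc hE'.subset_Icc hE.indep hE'.indep hlam hatt hinj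
  labeling := IsLabeling.composeEdges hE.subset_Icc hE'.subset_Icc hL hL' h

/-- If rainbow colorings or monochromatic hyperedges of size `d` can be forced with `B` nodes,
then rainbow colorings or `K` disconnected monochromatic hyperedges of size `d` can be forced
with `K * B` nodes. -/
theorem exists_isRainbow_or_family {C : Finset ℕ} {d B : ℕ}
    (hB : ∀ A : ℕ → Finset (Finset ℕ) → ℕ, (∀ j E, A j E ∈ C) → ∃ n E L,
      IsLabeledForest n E L ∧ n ≤ B ∧ (IsRainbow A C n E L ∨ HasMono A d E))
    (A : ℕ → Finset (Finset ℕ) → ℕ) (hA : ∀ j E, A j E ∈ C) (K : ℕ) :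
    ∃ n E L, IsLabeledForest n E L ∧ n ≤ K * B ∧ (IsRainbow A C n E L ∨
      ∃ (e : ℕ → Finset ℕ) (c : ℕ → ℕ), ∀ k < K, e k ∈ E ∧ (e k).card = d ∧
        ∀ v ∈ e k, onlineColor A E v = c k ∧ L v = k) := by
  induction K with
  | zero =>
    exact ⟨0, {∅}, fun _ => 0, isLabeledForest_empty, Nat.zero_le _,
      Or.inr ⟨fun _ => ∅, fun _ => 0, fun k hk => absurd hk (Nat.not_lt_zero k)⟩⟩
  | succ K ih =>
    obtain ⟨n, E, L, hE, hn, hR | ⟨e, c, hec⟩⟩ := ih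
    · exact ⟨n, E, L, hE, hn.trans (Nat.mul_le_mul_right _ (Nat.le_succ K)), Or.inl hR⟩
    obtain ⟨k, E', L', hE', hk, hout⟩ :=
      hB (inducedAlg A n (fun _ => 0) E) (fun _ _ => hA _ _)
    have hcol : ∀ j ≤ k, onlineColor A (composeEdges n k (fun _ => 0) E E') (n + j)
        = onlineColor (inducedAlg A n (fun _ => 0) E) E' j := fun j hj =>
      onlineColor_composeEdges_right A hE.subset_Icc hj hE'.subset_Icc
    have hforest : ∀ M : ℕ → ℕ, IsLabeling E' M →
        IsLabeledForest (n + k) (composeEdges n k (fun _ => 0) E E')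
          (fun v => if v ≤ n then L v else M (v - n)) := fun M hM =>
      hE.composeEdges (lam := fun _ => 0) hE' (fun _ _ _ _ _ _ => rfl)
        (fun _ _ h => absurd h (by omega)) (fun _ _ _ _ h => absurd h (by omega))
        hE.labeling hM (fun _ _ h => absurd h (by omega))
    have hnk : n + k ≤ (K + 1) * B := by rw [Nat.succ_mul]; omega
    rcases hout with ⟨f, hf, hfL⟩ | ⟨e', he', hcard, c', hc'⟩
    · refine ⟨n + k, _, _, hforest L' hE'.labeling, hnk, Or.inl ⟨fun c => n + f c, ?_, ?_⟩⟩
      · intro c hc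
        obtain ⟨h1, h2⟩ := hf c hc
        rw [Finset.mem_Icc] at h1
        exact ⟨Finset.mem_Icc.2 (by beta_reduce; omega), (hcol _ h1.2).trans h2⟩
      · intro c hc c' hc' h
        have h1 := Finset.mem_Icc.1 (hf c hc).1
        have h2 := Finset.mem_Icc.1 (hf c' hc').1
        beta_reduce at h
        rw [if_neg (by omega), if_neg (by omega), Nat.add_sub_cancel_left,
          Nat.add_sub_cancel_left] at h
        exact hfL c hc c' hc' h
    · refine ⟨n + k, _, _, hforest (fun _ => K) (fun _ _ _ _ _ _ => rfl), hnk, Or.inr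
        ⟨Function.update e K (shiftEdge n e'), Function.update c K c', ?_⟩⟩
      intro i hi
      by_cases hiK : i = K
      · subst hiK
        rw [Function.update_self, Function.update_self]
        refine ⟨Finset.mem_union_right _ (Finset.mem_image_of_mem _ he'), ?_, ?_⟩
        · rw [shiftEdge, Finset.card_image_of_injective _ (fun _ _ h => Nat.add_left_cancel h),
            hcard]
        · intro v hv
          obtain ⟨u, hu, rfl⟩ := mem_shiftEdge.1 hv
          have hu' := Finset.mem_Icc.1 (hE'.subset_Icc e' he' hu)
          exact ⟨(hcol u hu'.2).trans (hc' u hu), if_neg (by omega)⟩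
      · rw [Function.update_of_ne hiK, Function.update_of_ne hiK]
        obtain ⟨h1, h2, h3⟩ := hec i (by omega)
        refine ⟨Finset.mem_union_left _ (Finset.mem_image.2 ⟨e i, h1, by simp [extendEdge]⟩),
          h2, fun v hv => ?_⟩
        have hvn := (Finset.mem_Icc.1 (hE.subset_Icc _ h1 hv)).2
        refine ⟨?_, ?_⟩
        · rw [onlineColor_composeEdges_left A hE.empty_mem hvn hE'.subset_Icc]
          exact (h3 v hv).1
        · rw [if_pos hvn]
          exact (h3 v hv).2

theorem Finset.exists_injOn_numbering (T : Finset ℕ) :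
    ∃ ρ : ℕ → ℕ, Set.InjOn ρ T ∧ ∀ t < T.card, ∃ k ∈ T, ρ k = t := by
  refine ⟨fun k => if h : k ∈ T then (T.equivFin ⟨k, h⟩ : ℕ) else 0, ?_, ?_⟩
  · intro a ha b hb hab
    have ha' : a ∈ T := ha
    have hb' : b ∈ T := hb
    simp only [dif_pos ha', dif_pos hb'] at hab
    simpa using T.equivFin.injective (Fin.ext hab)
  · intro t ht
    refine ⟨T.equivFin.symm ⟨t, ht⟩, (T.equivFin.symm ⟨t, ht⟩).2, ?_⟩
    simp

/-- Every new node can be attached to a hyperedge of size `d` and color `x`: this either creates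
a monochromatic hyperedge of size `d + 1`, or forces the algorithm to avoid the color `x`. -/
theorem exists_isRainbow_or_hasMono_of_family {C : Finset ℕ} {d N n x c₀ : ℕ}
    {E : Finset (Finset ℕ)} {L : ℕ → ℕ} {e : ℕ → Finset ℕ} {T : Finset ℕ}
    (A : ℕ → Finset (Finset ℕ) → ℕ) (hA : ∀ j E, A j E ∈ C) (hd : 1 ≤ d) (hc₀ : c₀ ∈ C)
    (hx : x ≠ c₀)
    (hN : ∀ A : ℕ → Finset (Finset ℕ) → ℕ, (∀ j E, A j E ∈ C.erase x) → ∃ n E L,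
      IsLabeledForest n E L ∧ n ≤ N ∧ (IsRainbow A (C.erase x) n E L ∨ HasMono A (d + 1) E))
    (hE : IsLabeledForest n E L) (hT : N < T.card)
    (he : ∀ k ∈ T, e k ∈ E ∧ (e k).card = d ∧ ∀ v ∈ e k, onlineColor A E v = x ∧ L v = k) :
    ∃ n' E' L', IsLabeledForest n' E' L' ∧ n' ≤ n + N ∧
      (IsRainbow A C n' E' L' ∨ HasMono A (d + 1) E') := by
  classical
  obtain ⟨ρ, hρ, hρT⟩ := T.exists_injOn_numbering
  let lam : ℕ → ℕ := fun v => ρ (L v)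
  let att : Finset ℕ → ℕ := fun f => if f ∈ T.image e then f.sup lam else 0
  have hne : ∀ k ∈ T, (e k).Nonempty := fun k hk =>
    Finset.card_pos.1 (by rw [(he k hk).2.1]; exact hd)
  have hlam_e : ∀ k ∈ T, ∀ v ∈ e k, lam v = ρ k := fun k hk v hv =>
    congrArg ρ ((he k hk).2.2 v hv).2
  have hatt_e : ∀ k ∈ T, att (e k) = ρ k := by
    intro k hk
    simp only [att]
    rw [if_pos (Finset.mem_image_of_mem _ hk), Finset.sup_congr rfl (hlam_e k hk),
      Finset.sup_const (hne k hk)]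
  have hatt_pos : ∀ f, 1 ≤ att f → ∃ k ∈ T, f = e k := by
    intro f hf
    by_contra hcon
    have : f ∉ T.image e := fun h => by
      obtain ⟨k, hk, rfl⟩ := Finset.mem_image.1 h
      exact hcon ⟨k, hk, rfl⟩
    simp only [att, if_neg this] at hf
    omega
  have hatt : ∀ f ∈ E, 1 ≤ att f → f.Nonempty ∧ ∀ u ∈ f, lam u = att f := by
    intro f _ hf
    obtain ⟨k, hk, rfl⟩ := hatt_pos f hf
    rw [hatt_e k hk]
    exact ⟨hne k hk, hlam_e k hk⟩
  have hinj : ∀ f ∈ E, ∀ f' ∈ E, 1 ≤ att f → att f = att f' → f = f' := by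
    intro f _ f' _ hf hff
    obtain ⟨k, hk, rfl⟩ := hatt_pos f hf
    obtain ⟨k', hk', rfl⟩ := hatt_pos f' (hff ▸ hf)
    rw [hatt_e k hk, hatt_e k' hk'] at hff
    rw [hρ hk hk' hff]
  have hlam : IsLabeling E lam := fun f hf u hu w hw => congrArg ρ (hE.labeling f hf u hu w hw)
  obtain ⟨k, E', L', hE', hk, hout⟩ :=
    hN (fun j F => if inducedAlg A n att E j F = x then c₀ else inducedAlg A n att E j F) (by
      intro j F
      split_ifs with h
      · exact Finset.mem_erase.2 ⟨hx.symm, hc₀⟩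
      · exact Finset.mem_erase.2 ⟨h, hA _ _⟩)
  have hforest : IsLabeledForest (n + k) (composeEdges n k att E E')
      (fun v => if v ≤ n then (if 1 ≤ lam v ∧ lam v ≤ k then L' (lam v) + 1 else 0)
        else (fun j => L' j + 1) (v - n)) := by
    refine hE.composeEdges (L := fun v => if 1 ≤ lam v ∧ lam v ≤ k then L' (lam v) + 1 else 0)
      (L' := fun j => L' j + 1) hE' hlam hatt hinj ?_ ?_ ?_
    · intro f hf u hu w hw
      simp only [hlam f hf u hu w hw]
    · intro f hf u hu w hw
      exact congrArg (· + 1) (hE'.labeling f hf u hu w hw)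
    · intro f hf h1 h2 u hu
      simp only [(hatt f hf h1).2 u hu]
      rw [if_pos ⟨h1, h2⟩]
  have hcolL : ∀ v ≤ n, onlineColor A (composeEdges n k att E E') v = onlineColor A E v :=
    fun v hv => onlineColor_composeEdges_left A hE.empty_mem hv hE'.subset_Icc
  have hcolR : ∀ j ≤ k, onlineColor A (composeEdges n k att E E') (n + j)
      = onlineColor (inducedAlg A n att E) E' j := fun j hj =>
    onlineColor_composeEdges_right A hE.subset_Icc hj hE'.subset_Icc
  refine ⟨n + k, _, _, hforest, by omega, ?_⟩
  by_cases hex : ∃ j, 1 ≤ j ∧ j ≤ k ∧ onlineColor A (composeEdges n k att E E') (n + j) = x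
  · right
    obtain ⟨j, h1, h2, hj⟩ := hex
    obtain ⟨i, hi, hij⟩ := hρT j (by omega)
    have hatt_i : att (e i) = j := (hatt_e i hi).trans hij
    obtain ⟨hiE, hcard, hcol⟩ := he i hi
    refine ⟨extendEdge n k att (e i), Finset.mem_union_left _ (Finset.mem_image_of_mem _ hiE),
      ?_, x, ?_⟩
    · rw [extendEdge, if_pos (by omega), Finset.card_insert_of_notMem, hcard]
      intro h
      have := Finset.mem_Icc.1 (hE.subset_Icc _ hiE h)
      omega
    · intro v hv
      rcases mem_extendEdge.1 hv with hv | ⟨-, -, rfl⟩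
      · rw [hcolL v (Finset.mem_Icc.1 (hE.subset_Icc _ hiE hv)).2]
        exact (hcol v hv).1
      · rw [hatt_i, hj]
  · have hcol' : ∀ j, 1 ≤ j → j ≤ k →
        onlineColor A (composeEdges n k att E E') (n + j) = onlineColor
          (fun j F => if inducedAlg A n att E j F = x then c₀ else inducedAlg A n att E j F)
          E' j := by
      intro j h1 h2
      have hjx : onlineColor (inducedAlg A n att E) E' j ≠ x := fun h =>
        hex ⟨j, h1, h2, (hcolR j h2).trans h⟩
      rw [hcolR j h2]
      exact (if_neg hjx).symm
    rcases hout with ⟨f, hf, hfL⟩ | ⟨e', he', hcard, c', hc'⟩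
    · left
      obtain ⟨i, hi, hi0⟩ := hρT 0 (by omega)
      obtain ⟨w, hw⟩ := hne i hi
      have hwn := Finset.mem_Icc.1 (hE.subset_Icc _ (he i hi).1 hw)
      have hlamw : lam w = 0 := (hlam_e i hi w hw).trans hi0
      have hfk : ∀ c ∈ C, c ≠ x → 1 ≤ f c ∧ f c ≤ k := fun c hc hcx =>
        Finset.mem_Icc.1 (hf c (Finset.mem_erase.2 ⟨hcx, hc⟩)).1
      refine ⟨fun c => if c = x then w else n + f c, ?_, ?_⟩
      · intro c hc
        by_cases hcx : c = x
        · simp only [if_pos hcx]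
          refine ⟨Finset.mem_Icc.2 (by omega), ?_⟩
          rw [hcolL w hwn.2, hcx]
          exact ((he i hi).2.2 w hw).1
        · simp only [if_neg hcx]
          have := hfk c hc hcx
          refine ⟨Finset.mem_Icc.2 (by omega), ?_⟩
          rw [hcol' _ this.1 this.2]
          exact (hf c (Finset.mem_erase.2 ⟨hcx, hc⟩)).2
      · have hlabel : ∀ c ∈ C, ∀ g : ℕ → ℕ, c ≠ x →
            (if n + f c ≤ n then g (n + f c) else L' (n + f c - n) + 1) = L' (f c) + 1 := by
          intro c hc g hcx
          have := hfk c hc hcx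
          rw [if_neg (by omega), Nat.add_sub_cancel_left]
        have hlabelw : (if w ≤ n then (if 1 ≤ lam w ∧ lam w ≤ k then L' (lam w) + 1 else 0)
            else L' (w - n) + 1) = 0 := by
          rw [if_pos hwn.2, if_neg (by omega)]
        intro c hc c' hc' h
        by_cases hcx : c = x <;> by_cases hcx' : c' = x
        · rw [hcx, hcx']
        · simp only [if_pos hcx, if_neg hcx'] at h
          rw [hlabelw, hlabel c' hc' (fun v => if 1 ≤ lam v ∧ lam v ≤ k then L' (lam v) + 1
            else 0) hcx'] at h
          omega
        · simp only [if_neg hcx, if_pos hcx'] at h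
          rw [hlabelw, hlabel c hc (fun v => if 1 ≤ lam v ∧ lam v ≤ k then L' (lam v) + 1
            else 0) hcx] at h
          omega
        · simp only [if_neg hcx, if_neg hcx'] at h
          rw [hlabel c hc (fun v => if 1 ≤ lam v ∧ lam v ≤ k then L' (lam v) + 1 else 0) hcx,
            hlabel c' hc' (fun v => if 1 ≤ lam v ∧ lam v ≤ k then L' (lam v) + 1 else 0) hcx']
            at h
          exact hfL c (Finset.mem_erase.2 ⟨hcx, hc⟩) c' (Finset.mem_erase.2 ⟨hcx', hc'⟩)
            (Nat.add_right_cancel h)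
    · right
      refine ⟨shiftEdge n e', Finset.mem_union_right _ (Finset.mem_image_of_mem _ he'), ?_,
        c', ?_⟩
      · rw [shiftEdge, Finset.card_image_of_injective _ (fun _ _ h => Nat.add_left_cancel h),
          hcard]
      · intro v hv
        obtain ⟨u, hu, rfl⟩ := mem_shiftEdge.1 hv
        have hu' := Finset.mem_Icc.1 (hE'.subset_Icc e' he' hu)
        rw [hcol' u hu'.1 hu'.2]
        exact hc' u hu

theorem Xrec_one_left (d : ℕ) : Xrec 1 d = 1 := by
  cases d <;> simp [Xrec]

theorem Xrec_one_right (m : ℕ) : Xrec m 1 = 1 := by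
  rcases m with _ | _ | m <;> simp [Xrec]

theorem Xrec_add_two (m d : ℕ) : Xrec (m + 2) (d + 2) =
    Xrec (m + 1) (d + 2) * ((m + 1) * Xrec (m + 2) (d + 1) + 1) + Xrec (m + 2) (d + 1) := by
  rw [Xrec]

/-- Against any online algorithm with `m` colors, `Xrec m d` nodes suffice to force all colors
in distinct components or a monochromatic hyperedge of size `d`. -/
theorem exists_isRainbow_or_hasMono (m d : ℕ) (C : Finset ℕ) (hC : C.card = m + 1)
    (A : ℕ → Finset (Finset ℕ) → ℕ) (hA : ∀ j E, A j E ∈ C) :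
    ∃ n E L, IsLabeledForest n E L ∧ n ≤ Xrec (m + 1) (d + 1) ∧
      (IsRainbow A C n E L ∨ HasMono A (d + 1) E) := by
  induction m generalizing d C A with
  | zero =>
    obtain ⟨c, rfl⟩ := Finset.card_eq_one.1 hC
    refine ⟨1, _, _, isLabeledForest_singleton, (Xrec_one_left _).ge, Or.inl
      ⟨fun _ => 1, fun c' hc' => ⟨by simp, ?_⟩, fun a ha b hb _ => ?_⟩⟩
    · rw [Finset.mem_singleton.1 hc']
      exact Finset.mem_singleton.1 (hA _ _)
    · rw [Finset.mem_singleton.1 ha, Finset.mem_singleton.1 hb]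
  | succ m ihm =>
    induction d generalizing A with
    | zero =>
      refine ⟨1, _, _, isLabeledForest_singleton, (Xrec_one_right _).ge, Or.inr
        ⟨{1}, by decide, rfl, onlineColor A {∅, {1}} 1, fun v hv => ?_⟩⟩
      rw [Finset.mem_singleton.1 hv]
    | succ d ihd =>
      obtain ⟨n, E, L, hE, hn, hR | ⟨e, c, hec⟩⟩ :=
        exists_isRainbow_or_family ihd A hA ((m + 1) * Xrec (m + 1) (d + 2) + 1)
      · refine ⟨n, E, L, hE, hn.trans ?_, Or.inl hR⟩
        rw [Xrec_add_two]
        nlinarith [Nat.zero_le (Xrec (m + 1) (d + 2))]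
      have hne : ∀ k < (m + 1) * Xrec (m + 1) (d + 2) + 1, ∃ w, w ∈ e k := fun k hk =>
        Finset.card_pos.1 (by rw [(hec k hk).2.1]; omega)
      by_cases hall : ∀ x ∈ C, ∃ k < (m + 1) * Xrec (m + 1) (d + 2) + 1, c k = x
      · have hsel : ∀ x, ∃ w, x ∈ C → ∃ k < (m + 1) * Xrec (m + 1) (d + 2) + 1,
            c k = x ∧ w ∈ e k := by
          intro x
          by_cases hx : x ∈ C
          · obtain ⟨k, hk, hkx⟩ := hall x hx
            obtain ⟨w, hw⟩ := hne k hk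
            exact ⟨w, fun _ => ⟨k, hk, hkx, hw⟩⟩
          · exact ⟨0, fun h => absurd h hx⟩
        choose f hf using hsel
        refine ⟨n, E, L, hE, hn.trans ?_, Or.inl ⟨f, fun x hx => ?_, fun x hx y hy hxy => ?_⟩⟩
        · rw [Xrec_add_two]
          nlinarith [Nat.zero_le (Xrec (m + 1) (d + 2))]
        · obtain ⟨k, hk, rfl, hw⟩ := hf x hx
          exact ⟨hE.subset_Icc _ (hec k hk).1 hw, ((hec k hk).2.2 _ hw).1⟩
        · obtain ⟨k, hk, hkx, hw⟩ := hf x hx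
          obtain ⟨k', hk', hky, hw'⟩ := hf y hy
          rw [((hec k hk).2.2 _ hw).2, ((hec k' hk').2.2 _ hw').2] at hxy
          rw [← hkx, ← hky, hxy]
      · push Not at hall
        obtain ⟨c₀, hc₀, hmiss⟩ := hall
        obtain ⟨x, hx, hcard⟩ := Finset.exists_lt_card_fiber_of_mul_lt_card_of_maps_to
          (s := Finset.range ((m + 1) * Xrec (m + 1) (d + 2) + 1)) (t := C.erase c₀) (f := c)
          (n := Xrec (m + 1) (d + 2)) (by
            intro k hk
            have hk' := Finset.mem_range.1 hk
            obtain ⟨w, hw⟩ := hne k hk'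
            refine Finset.mem_erase.2 ⟨hmiss k hk', ?_⟩
            rw [← ((hec k hk').2.2 w hw).1]
            exact hA _ _) (by
            rw [Finset.card_erase_of_mem hc₀, hC, Finset.card_range]
            simp)
        obtain ⟨hxc, hxC⟩ := Finset.mem_erase.1 hx
        obtain ⟨n', E', L', hE', hn', hout⟩ := exists_isRainbow_or_hasMono_of_family A hA
          (Nat.succ_pos d) hc₀ hxc
          (ihm (d + 1) (C.erase x) (by rw [Finset.card_erase_of_mem hxC, hC]; rfl)) hE hcard
          (fun k hk => by
            obtain ⟨hk, hkx⟩ := Finset.mem_filter.1 hk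
            have := hec k (Finset.mem_range.1 hk)
            rwa [hkx] at this)
        refine ⟨n', E', L', hE', hn'.trans ?_, hout⟩
        rw [Xrec_add_two]
        calc n + Xrec (m + 1) (d + 2)
            ≤ ((m + 1) * Xrec (m + 1) (d + 2) + 1) * Xrec (m + 1 + 1) (d + 1)
              + Xrec (m + 1) (d + 2) := Nat.add_le_add_right hn _
          _ = _ := by ring

theorem Xrec_pos (m d : ℕ) : 1 ≤ Xrec (m + 1) (d + 1) := by
  induction d with
  | zero => exact (Xrec_one_right _).ge
  | succ d ih =>
    rcases m with _ | m
    · exact (Xrec_one_left _).ge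
    · rw [Xrec_add_two]
      exact ih.trans (Nat.le_add_left _ _)

theorem mul_Xrec_le (m d : ℕ) : (m + 2) * Xrec (m + 2) (d + 1) ≤ Xrec (m + 2) (d + 2) := by
  rw [Xrec_add_two]
  nlinarith [Nat.mul_le_mul_right ((m + 1) * Xrec (m + 2) (d + 1) + 1) (Xrec_pos m (d + 1))]

theorem Xrec_succ_le_pow (m d : ℕ) :
    Xrec (m + 3) (d + 1) ≤ Xrec (m + 2) (d + 1) ^ (d + 2) := by
  induction d with
  | zero => simp [Xrec_one_right]
  | succ d ih =>
    set a := Xrec (m + 2) (d + 2) with ha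
    set b := Xrec (m + 2) (d + 1) with hb
    set x := Xrec (m + 3) (d + 1) with hx
    have hapos : 1 ≤ a := Xrec_pos (m + 1) (d + 1)
    have hxpos : 1 ≤ x := Xrec_pos (m + 2) d
    have hstep : Xrec (m + 3) (d + 2) ≤ a * ((m + 4) * x) := by
      rw [Xrec_add_two (m + 1) d]
      have h1 : x ≤ a * x := Nat.le_mul_of_pos_left x hapos
      have h2 : a ≤ a * x := Nat.le_mul_of_pos_right a hxpos
      calc a * ((m + 1 + 1) * x + 1) + x = (m + 2) * (a * x) + a + x := by ring
        _ ≤ (m + 2) * (a * x) + a * x + a * x := by omega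
        _ = a * ((m + 4) * x) := by ring
    have hm : m + 4 ≤ (m + 2) ^ (d + 2) := by
      calc m + 4 ≤ (m + 2) ^ 2 := by nlinarith
        _ ≤ (m + 2) ^ (d + 2) := Nat.pow_le_pow_right (by omega) (by omega)
    calc Xrec (m + 3) (d + 2) ≤ a * ((m + 4) * x) := hstep
      _ ≤ a * ((m + 2) ^ (d + 2) * b ^ (d + 2)) :=
        Nat.mul_le_mul_left _ (Nat.mul_le_mul hm ih)
      _ = a * ((m + 2) * b) ^ (d + 2) := by rw [mul_pow]
      _ ≤ a * a ^ (d + 2) :=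
        Nat.mul_le_mul_left _ (Nat.pow_le_pow_left (mul_Xrec_le m d) _)
      _ = a ^ (d + 1 + 2) := by ring

theorem Xrec_le_Yrec_two (m : ℕ) : Xrec (m + 2) (m + 1) ≤ Yrec (m + 1) 2 := by
  induction m with
  | zero => rw [Xrec_one_right]; simp [Yrec]
  | succ m ih =>
    have hx : Xrec (m + 3) (m + 1) ≤ Yrec (m + 1) 2 ^ (m + 2) :=
      (Xrec_succ_le_pow m m).trans (Nat.pow_le_pow_left ih _)
    rw [Xrec_add_two (m + 1) m, Yrec, Yrec]
    set y := Yrec (m + 1) 2 ^ (m + 2)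
    set x := Xrec (m + 3) (m + 1)
    set a := Xrec (m + 2) (m + 2)
    calc a * ((m + 1 + 1) * x + 1) + x ≤ ((m + 2) * x + 1) * (a + 1) := by nlinarith
      _ ≤ ((m + 2) ^ 2 * (y + 1)) * (a + 1) := by
        refine Nat.mul_le_mul_right _ ?_
        calc (m + 2) * x + 1 ≤ (m + 2) * (y + 1) := by nlinarith
          _ ≤ (m + 2) ^ 2 * (y + 1) := Nat.mul_le_mul_right _ (by nlinarith)
      _ ≤ _ := by
        simp only [Nat.zero_add]
        omega

theorem Xrec_le_Yrec (m d : ℕ) : Xrec (m + 2) (m + 1) ≤ Yrec (m + 1) (d + 2) := by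
  induction d with
  | zero => exact Xrec_le_Yrec_two m
  | succ d ih =>
    refine ih.trans ?_
    rcases m with _ | m
    · simp [Yrec]
    · rw [Yrec.eq_5 m (d + 1)]
      nlinarith [Nat.zero_le ((m + 2) * Yrec (m + 1) (d + 1 + 2) ^ (m + 3)),
        Nat.mul_le_mul_right (Yrec (m + 2) (d + 2) + 1)
          (show 1 ≤ (m + 2) ^ 2 * (Yrec (m + 1) (d + 1 + 2) ^ (m + 2) + 1) from
            Nat.succ_le_of_lt (by positivity))]

theorem Yrec_one_right (m : ℕ) : Yrec (m + 1) 1 = Xrec (m + 1) (m + 1) := by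
  rcases m with _ | m <;> simp [Yrec, Xrec_one_right]

/-- **Lemma.** For all `m, d ≥ 1`, every deterministic online algorithm for `OMHC(m)` admits
a hyperforest instance with at most `Y(m,d)` nodes on which its coloring either yields, for
every color `i`, a hyperedge `e_i` of size `d` all of whose nodes have color `i`, these
hyperedges lying in pairwise distinct connected components, or makes some hyperedge of size
`m` monochromatic. -/
theorem omhc_mono_edges_of_all_colors_or_mono_m_edge (m d : ℕ) (hm : 1 ≤ m) (hd : 1 ≤ d)
    (A : OMHCAlg m) :
    ∃ I : OMHCInstance, IsHyperforest I.E ∧ I.n ≤ Yrec m d ∧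
      ((∃ e : Fin m → Finset ℕ,
          (∀ i, e i ∈ I.E ∧ (e i).card = d ∧ ∀ v ∈ e i, omhcAssign A I v = i) ∧
          ∀ i i' : Fin m, i ≠ i' → ∀ u ∈ e i, ∀ w ∈ e i', ¬ HConnected I.E u w) ∨
        ∃ e ∈ I.E, e.card = m ∧ ∀ v ∈ e, ∀ w ∈ e, omhcAssign A I v = omhcAssign A I w) := by
  obtain ⟨m, rfl⟩ : ∃ k, m = k + 1 := ⟨m - 1, by omega⟩
  obtain rfl | hd2 : d = 1 ∨ 2 ≤ d := by omega
  · let sing : ℕ → Finset (Finset ℕ) := fun j => (Finset.Icc 1 j).image (fun i => {i})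
    obtain ⟨n, E, L, hE, hn, hout⟩ := exists_isRainbow_or_hasMono m m (Finset.range (m + 1))
      (Finset.card_range _) (fun j F => (A j (F ∪ sing j)).val)
      (fun _ _ => Finset.mem_range.2 (Fin.is_lt _))
    have hsub : ∀ e ∈ E ∪ sing n, e ⊆ Finset.Icc 1 n := by
      intro e he
      rcases Finset.mem_union.1 he with he | he
      · exact hE.subset_Icc e he
      · obtain ⟨i, hi, rfl⟩ := Finset.mem_image.1 he
        exact Finset.singleton_subset_iff.2 hi
    have hlab : IsLabeling (E ∪ sing n) L := by
      intro e he u hu w hw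
      rcases Finset.mem_union.1 he with he | he
      · exact hE.labeling e he u hu w hw
      · obtain ⟨i, hi, rfl⟩ := Finset.mem_image.1 he
        rw [Finset.mem_singleton.1 hu, Finset.mem_singleton.1 hw]
    have hcol : ∀ v ≤ n, (omhcAssign A ⟨n, E ∪ sing n, hsub⟩ v).val
        = onlineColor (fun j F => (A j (F ∪ sing j)).val) E v := by
      intro v hv
      unfold omhcAssign onlineColor
      have himage : (E ∪ sing n).image (fun e => e ∩ Finset.Icc 1 v)
          = E.image (fun e => e ∩ Finset.Icc 1 v) ∪ sing v := by
        ext f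
        simp only [Finset.mem_image, Finset.mem_union, sing]
        constructor
        · rintro ⟨e, he | ⟨i, hi, rfl⟩, rfl⟩
          · exact Or.inl ⟨e, he, rfl⟩
          · by_cases hiv : i ∈ Finset.Icc 1 v
            · exact Or.inr ⟨i, hiv, (Finset.singleton_inter_of_mem hiv).symm⟩
            · exact Or.inl ⟨∅, hE.empty_mem, by
                rw [Finset.singleton_inter_of_notMem hiv, Finset.empty_inter]⟩
        · rintro (⟨e, he, rfl⟩ | ⟨i, hi, rfl⟩)
          · exact ⟨e, Or.inl he, rfl⟩
          · exact ⟨{i}, Or.inr ⟨i, Finset.Icc_subset_Icc_right hv hi, rfl⟩,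
              Finset.singleton_inter_of_mem hi⟩
      simp only [himage]
    refine ⟨⟨n, E ∪ sing n, hsub⟩, ?_, by rw [Yrec_one_right]; exact hn, ?_⟩
    · refine hE.indep.isHyperforest fun e he u hu w hw huw => ?_
      rcases Finset.mem_union.1 he with he | he
      · exact he
      · obtain ⟨i, hi, rfl⟩ := Finset.mem_image.1 he
        exact absurd ((Finset.mem_singleton.1 hu).trans (Finset.mem_singleton.1 hw).symm) huw
    · rcases hout with ⟨f, hf, hfL⟩ | ⟨e, he, hcard, c, hc⟩
      · refine Or.inl ⟨fun i => {f i}, fun i => ⟨?_, Finset.card_singleton _, ?_⟩, ?_⟩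
        · exact Finset.mem_union_right _
            (Finset.mem_image_of_mem _ (hf i (Finset.mem_range.2 i.is_lt)).1)
        · intro v hv
          rw [Finset.mem_singleton.1 hv]
          obtain ⟨h1, h2⟩ := hf i (Finset.mem_range.2 i.is_lt)
          exact Fin.ext ((hcol _ (Finset.mem_Icc.1 h1).2).trans h2)
        · intro i i' hii u hu w hw h
          rw [Finset.mem_singleton.1 hu, Finset.mem_singleton.1 hw] at h
          exact hii (Fin.ext (hfL i (Finset.mem_range.2 i.is_lt) i'
            (Finset.mem_range.2 i'.is_lt) (hlab.eq_of_hconnected h)))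
      · refine Or.inr ⟨e, Finset.mem_union_left _ he, hcard, fun v hv w hw => Fin.ext ?_⟩
        rw [hcol v (Finset.mem_Icc.1 (hE.subset_Icc e he hv)).2,
          hcol w (Finset.mem_Icc.1 (hE.subset_Icc e he hw)).2, hc v hv, hc w hw]
  · obtain ⟨d, rfl⟩ : ∃ k, d = k + 2 := ⟨d - 2, by omega⟩
    -- An algorithm with `m + 1` colors never uses all of `m + 2` colors.
    obtain ⟨n, E, L, hE, hn, ⟨f, hf, -⟩ | ⟨e, he, hcard, c, hc⟩⟩ :=
      exists_isRainbow_or_hasMono (m + 1) m (Finset.range (m + 2)) (Finset.card_range _)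
        (fun j F => (A j F).val)
        (fun j F => Finset.mem_range.2 ((A j F).is_lt.trans (Nat.lt_succ_self _)))
    · have h := (hf (m + 1) (Finset.mem_range.2 (Nat.lt_succ_self _))).2
      exact absurd h (Nat.ne_of_lt (Fin.is_lt _))
    · refine ⟨⟨n, E, hE.subset_Icc⟩, hE.indep.isHyperforest fun e he _ _ _ _ _ => he,
        hn.trans (Xrec_le_Yrec m d), Or.inr ⟨e, he, hcard, fun v hv w hw => Fin.ext ?_⟩⟩
      exact (hc v hv).trans (hc w hw).symm
end

section
/- Let m ≥ 1 be an integer. For every deterministic online algorithm A for OMHC(m), there exists a hyperforest instance H with at most (2m+1)↑↑5 nodes (where x↑↑5 = x^(x^(x^(x^x)))), at most m·((2m+1)↑↑5) hyperedges, and all hyperedges of size at most m, such that OPT(H) = 1 and A's coloring of H contains a monochromatic hyperedge of size m. In particular, for every ε > 0 there is no (m−ε)-competitive deterministic online algorithm for OMHC(m), even restricted to such hyperforests. -/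
open Finset

/-- `x ↑↑ 5 = x^(x^(x^(x^x)))`, a tower of height `5`. -/
def tower5 (x : ℕ) : ℕ := x ^ x ^ x ^ x ^ x

/-- Every node has a larger node in at most one of the hyperedges containing it. -/
def UniqueUp (E : Finset (Finset ℕ)) : Prop :=
  ∀ e ∈ E, ∀ f ∈ E, ∀ x ∈ e, x ∈ f → (∃ y ∈ e, x < y) → (∃ y ∈ f, x < y) → e = f

theorem UniqueUp.isHyperforest {E : Finset (Finset ℕ)} (h : UniqueUp E) : IsHyperforest E := by
  rintro ⟨l, v, e, hl, hE, hne, hv⟩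
  obtain ⟨t, ht, hmin⟩ :=
    Finset.exists_min_image (Finset.range l) v ⟨0, Finset.mem_range.2 hl⟩
  rw [Finset.mem_range] at ht
  obtain ⟨s, hs, hst⟩ : ∃ s < l, (s + 1) % l = t := by
    rcases Nat.eq_zero_or_pos t with rfl | h0
    · exact ⟨l - 1, by omega, by rw [Nat.sub_add_cancel hl, Nat.mod_self]⟩
    · exact ⟨t - 1, by omega, by rw [Nat.sub_add_cancel h0, Nat.mod_eq_of_lt ht]⟩
  obtain ⟨hs1, hs2, hs3⟩ := hv s hs
  obtain ⟨ht1, ht2, ht3⟩ := hv t ht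
  rw [hst] at hs2 hs3
  have hn : (t + 1) % l < l := Nat.mod_lt _ hl
  have h1 := hmin _ (Finset.mem_range.2 hs)
  have h2 := hmin _ (Finset.mem_range.2 hn)
  have hee : e s = e t := h _ (hE s hs) _ (hE t ht) (v t) hs2 ht1
    ⟨v s, hs1, lt_of_le_of_ne h1 hs3.symm⟩ ⟨_, ht2, lt_of_le_of_ne h2 ht3⟩
  refine hne s hs t ht ?_ hee
  rintro rfl
  exact hs3 rfl

/-- Coloring the nodes in decreasing order makes every hyperedge rainbow. -/
theorem UniqueUp.exists_rainbow {m n : ℕ} (hm : 1 ≤ m) {E : Finset (Finset ℕ)} (h : UniqueUp E)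
    (hE : ∀ e ∈ E, e ⊆ Finset.Icc 1 n) (hc : ∀ e ∈ E, e.card ≤ m) :
    ∃ φ : ℕ → Fin m, ∀ e ∈ E, ∀ x ∈ e, ∀ y ∈ e, x < y → φ x ≠ φ y := by
  suffices H : ∀ k, ∃ φ : ℕ → Fin m, ∀ e ∈ E, ∀ x ∈ e, ∀ y ∈ e, x < y → n < x + k →
      φ x ≠ φ y by
    obtain ⟨φ, hφ⟩ := H (n + 1)
    exact ⟨φ, fun e he x hx y hy hxy => hφ e he x hx y hy hxy (by omega)⟩
  intro k
  induction k with
  | zero =>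
    refine ⟨fun _ => ⟨0, hm⟩, fun e he x hx y hy hxy hn => ?_⟩
    have := Finset.mem_Icc.1 (hE e he hx)
    omega
  | succ k ih =>
    obtain ⟨φ, hφ⟩ := ih
    by_cases hex : ∃ e ∈ E, n - k ∈ e ∧ ∃ y ∈ e, n - k < y
    · obtain ⟨e₀, he₀, hx₀, hy₀⟩ := hex
      obtain ⟨c, hcn⟩ : ∃ c, c ∉ (e₀.erase (n - k)).image φ := by
        by_contra! hall
        have h1 : (Finset.univ : Finset (Fin m)) ⊆ (e₀.erase (n - k)).image φ :=
          fun c _ => hall c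
        have h2 := (Finset.card_le_card h1).trans Finset.card_image_le
        rw [Finset.card_univ, Fintype.card_fin] at h2
        have h3 := Finset.card_erase_lt_of_mem hx₀
        have h4 := hc e₀ he₀
        omega
      refine ⟨Function.update φ (n - k) c, fun e he x hx y hy hxy hn => ?_⟩
      by_cases hxk : x = n - k
      · have hee : e = e₀ := h e he e₀ he₀ (n - k) (hxk ▸ hx) hx₀ ⟨y, hy, hxk ▸ hxy⟩ hy₀
        have hyk : y ≠ n - k := by omega
        rw [hxk, Function.update_self, Function.update_of_ne hyk]
        rintro rfl
        exact hcn (Finset.mem_image_of_mem φ (Finset.mem_erase.2 ⟨hyk, hee ▸ hy⟩))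
      · rw [Function.update_of_ne hxk, Function.update_of_ne (by omega)]
        exact hφ e he x hx y hy hxy (by omega)
    · refine ⟨φ, fun e he x hx y hy hxy hn => ?_⟩
      by_cases hxk : x = n - k
      · exact absurd ⟨e, he, hxk ▸ hx, y, hy, hxk ▸ hxy⟩ hex
      · exact hφ e he x hx y hy hxy (by omega)

/-- Invariants of the instances built by the adversary. -/
structure AdversaryInstance (m : ℕ) (I : OMHCInstance) : Prop where
  empty_mem : ∅ ∈ I.E
  uniqueUp : UniqueUp I.E
  card_edge_le : ∀ e ∈ I.E, e.card ≤ m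
  card_le : I.E.card ≤ I.n + 1

/-- A family of disjoint hyperedges, the one at index `p` being monochromatic of color `p.1`,
that can all be extended by a new node. -/
structure Extendable {m : ℕ} (A : OMHCAlg m) (I : OMHCInstance) (T : Fin m × ℕ → Finset ℕ)
    (S : Set (Fin m × ℕ)) : Prop where
  mem : ∀ p ∈ S, T p ∈ I.E
  free : ∀ p ∈ S, ∀ x ∈ T p, ∀ e ∈ I.E, x ∈ e → e = T p ∨ ∀ y ∈ e, y ≤ x
  mono : ∀ p ∈ S, ∀ x ∈ T p, omhcAssign A I x = p.1
  disj : ∀ p ∈ S, ∀ q ∈ S, p ≠ q → Disjoint (T p) (T q)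

theorem Extendable.comp {m : ℕ} {A : OMHCAlg m} {I : OMHCInstance} {T : Fin m × ℕ → Finset ℕ}
    {S S' : Set (Fin m × ℕ)} (h : Extendable A I T S) {f : Fin m × ℕ → Fin m × ℕ}
    (hf : Set.MapsTo f S' S) (hinj : Set.InjOn f S') (hfst : ∀ p ∈ S', (f p).1 = p.1) :
    Extendable A I (T ∘ f) S' where
  mem _ hp := h.mem _ (hf hp)
  free _ hp := h.free _ (hf hp)
  mono p hp x hx := (h.mono _ (hf hp) x hx).trans (hfst p hp)
  disj _ hp _ hq hpq := h.disj _ (hf hp) _ (hf hq) fun he => hpq (hinj hp hq he)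

/-- The instance in which a new last node joins all hyperedges of `P`. -/
def OMHCInstance.extend (I : OMHCInstance) (P : Finset (Finset ℕ)) (hP : P ⊆ I.E) :
    OMHCInstance where
  n := I.n + 1
  E := insert ∅ ((I.E \ P) ∪ P.image (insert (I.n + 1)))
  hE := by
    have hsub : Finset.Icc 1 I.n ⊆ Finset.Icc 1 (I.n + 1) :=
      Finset.Icc_subset_Icc_right (Nat.le_succ _)
    intro e he
    simp only [Finset.mem_insert, Finset.mem_union, Finset.mem_sdiff, Finset.mem_image] at he
    rcases he with rfl | ⟨he, -⟩ | ⟨e, he, rfl⟩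
    · exact Finset.empty_subset _
    · exact (I.hE e he).trans hsub
    · exact Finset.insert_subset (by simp) ((I.hE e (hP he)).trans hsub)

theorem OMHCInstance.mem_extend {I : OMHCInstance} {P : Finset (Finset ℕ)} {hP : P ⊆ I.E}
    {e : Finset ℕ} : e ∈ (I.extend P hP).E ↔
      e = ∅ ∨ (e ∈ I.E ∧ e ∉ P) ∨ ∃ f ∈ P, insert (I.n + 1) f = e := by
  simp [OMHCInstance.extend]

theorem OMHCInstance.le_of_mem {I : OMHCInstance} {e : Finset ℕ} (he : e ∈ I.E) {x : ℕ}
    (hx : x ∈ e) : x ≤ I.n :=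
  (Finset.mem_Icc.1 (I.hE e he hx)).2

theorem omhcAssign_extend {m : ℕ} (A : OMHCAlg m) {I : OMHCInstance} (h0 : ∅ ∈ I.E)
    {P : Finset (Finset ℕ)} (hP : P ⊆ I.E) {j : ℕ} (hj : j ≤ I.n) :
    omhcAssign A (I.extend P hP) j = omhcAssign A I j := by
  have hins : ∀ f : Finset ℕ, insert (I.n + 1) f ∩ Finset.Icc 1 j = f ∩ Finset.Icc 1 j := by
    intro f
    refine Finset.insert_inter_of_notMem ?_
    rw [Finset.mem_Icc]
    omega
  unfold omhcAssign
  congr 1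
  ext g
  simp only [Finset.mem_image, OMHCInstance.mem_extend]
  constructor
  · rintro ⟨e, rfl | ⟨he, -⟩ | ⟨f, hf, rfl⟩, rfl⟩
    · exact ⟨∅, h0, rfl⟩
    · exact ⟨e, he, rfl⟩
    · exact ⟨f, hP hf, (hins f).symm⟩
  · rintro ⟨e, he, rfl⟩
    by_cases heP : e ∈ P
    · exact ⟨_, Or.inr (Or.inr ⟨e, heP, rfl⟩), hins e⟩
    · exact ⟨e, Or.inr (Or.inl ⟨he, heP⟩), rfl⟩

/-- The adversary lets a new node join the `k`-th hyperedge of every color. -/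
theorem exists_extend {m : ℕ} (A : OMHCAlg m) {I : OMHCInstance} (hI : AdversaryInstance m I)
    {T : Fin m × ℕ → Finset ℕ} {S : Set (Fin m × ℕ)} (hT : Extendable A I T S) (k : ℕ)
    (hk : ∀ c, (c, k) ∈ S) (hcard : ∀ c, (T (c, k)).card < m) :
    ∃ (I' : OMHCInstance) (c : Fin m) (P : Finset ℕ), AdversaryInstance m I' ∧
      I'.n = I.n + 1 ∧ P.card = (T (c, k)).card + 1 ∧
      Extendable A I' (Function.update T (c, k) P) (S \ {p | p.2 = k ∧ p.1 ≠ c}) := by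
  classical
  set Q : Finset (Finset ℕ) := Finset.univ.image (fun c => T (c, k)) with hQ
  have memQ : ∀ f, f ∈ Q ↔ ∃ c, T (c, k) = f := by simp [hQ]
  have hQE : Q ⊆ I.E := by
    intro f hf
    obtain ⟨c, rfl⟩ := (memQ f).1 hf
    exact hT.mem _ (hk c)
  have eq_of_mem : ∀ p ∈ S, ∀ q ∈ S, ∀ x ∈ T p, x ∈ T q → p = q := by
    intro p hp q hq x hxp hxq
    by_contra hpq
    exact Finset.disjoint_left.1 (hT.disj p hp q hq hpq) hxp hxq
  have notMem : ∀ p ∈ S, I.n + 1 ∉ T p := fun p hp hx => by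
    have := OMHCInstance.le_of_mem (hT.mem p hp) hx
    omega
  set I' := I.extend Q hQE with hI'
  set c := omhcAssign A I' (I.n + 1) with hc
  have hmem : ∀ e, e ∈ I'.E ↔
      e = ∅ ∨ (e ∈ I.E ∧ e ∉ Q) ∨ ∃ d, insert (I.n + 1) (T (d, k)) = e := by
    intro e
    rw [hI', OMHCInstance.mem_extend]
    simp [memQ]
  have hn : I'.n = I.n + 1 := rfl
  have free' : ∀ d, ∀ x ∈ T (d, k), ∀ e ∈ I.E, e ∉ Q → x ∈ e → ∀ y ∈ e, y ≤ x := by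
    intro d x hx e he heQ hxe
    rcases hT.free _ (hk d) x hx e he hxe with rfl | h
    · exact absurd ((memQ _).2 ⟨d, rfl⟩) heQ
    · exact h
  refine ⟨I', c, insert (I.n + 1) (T (c, k)), ⟨?_, ?_, ?_, ?_⟩, hn,
    Finset.card_insert_of_notMem (notMem _ (hk c)), ⟨?_, ?_, ?_, ?_⟩⟩
  · exact (hmem _).2 (Or.inl rfl)
  · intro e he f hf x hxe hxf ⟨y, hye, hxy⟩ ⟨z, hzf, hxz⟩
    have hxn : x ≠ I.n + 1 := by
      have := OMHCInstance.le_of_mem he hye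
      omega
    rcases (hmem e).1 he with rfl | ⟨he, heQ⟩ | ⟨d, rfl⟩
    · simp at hxe
    · rcases (hmem f).1 hf with rfl | ⟨hf, hfQ⟩ | ⟨d', rfl⟩
      · simp at hxf
      · exact hI.uniqueUp e he f hf x hxe hxf ⟨y, hye, hxy⟩ ⟨z, hzf, hxz⟩
      · have := free' d' x (Finset.mem_of_mem_insert_of_ne hxf hxn) e he heQ hxe y hye
        omega
    · have hxd := Finset.mem_of_mem_insert_of_ne hxe hxn
      rcases (hmem f).1 hf with rfl | ⟨hf, hfQ⟩ | ⟨d', rfl⟩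
      · simp at hxf
      · have := free' d x hxd f hf hfQ hxf z hzf
        omega
      · rw [eq_of_mem _ (hk d) _ (hk d') x hxd (Finset.mem_of_mem_insert_of_ne hxf hxn)]
  · intro e he
    rcases (hmem e).1 he with rfl | ⟨he, -⟩ | ⟨d, rfl⟩
    · simp
    · exact hI.card_edge_le e he
    · exact (Finset.card_insert_le _ _).trans (hcard d)
  · calc I'.E.card ≤ ((I.E \ Q) ∪ Q.image (insert (I.n + 1))).card + 1 :=
          Finset.card_insert_le ∅ _
      _ ≤ (I.E \ Q).card + (Q.image (insert (I.n + 1))).card + 1 := by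
          exact Nat.add_le_add_right (Finset.card_union_le _ _) 1
      _ ≤ (I.E \ Q).card + Q.card + 1 := by
          exact Nat.add_le_add_right (Nat.add_le_add_left Finset.card_image_le _) 1
      _ = I.E.card + 1 := by rw [Finset.card_sdiff_add_card_eq_card hQE]
      _ ≤ I'.n + 1 := by
          rw [hn]
          exact Nat.succ_le_succ hI.card_le
  · rintro p ⟨hp, hpk⟩
    by_cases hpc : p = (c, k)
    · rw [hpc, Function.update_self]
      exact (hmem _).2 (Or.inr (Or.inr ⟨c, rfl⟩))
    · rw [Function.update_of_ne hpc]
      by_cases hpQ : T p ∈ Q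
      · obtain ⟨d, hd⟩ := (memQ _).1 hpQ
        have hpd : p ≠ (d, k) := by
          rintro rfl
          exact hpk ⟨rfl, fun h => hpc (by rw [← h])⟩
        have hdis := hT.disj p hp _ (hk d) hpd
        rw [hd, Finset.disjoint_self_iff_empty] at hdis
        exact (hmem _).2 (Or.inl hdis)
      · exact (hmem _).2 (Or.inr (Or.inl ⟨hT.mem p hp, hpQ⟩))
  · rintro p ⟨hp, hpk⟩ x hx e he hxe
    by_cases hpc : p = (c, k)
    · rw [hpc, Function.update_self] at hx ⊢
      by_cases hxn : x = I.n + 1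
      · exact Or.inr fun y hy => hxn ▸ OMHCInstance.le_of_mem he hy
      · have hxc := Finset.mem_of_mem_insert_of_ne hx hxn
        rcases (hmem e).1 he with rfl | ⟨he, heQ⟩ | ⟨d, rfl⟩
        · simp at hxe
        · exact Or.inr (free' c x hxc e he heQ hxe)
        · left
          rw [eq_of_mem _ (hk d) _ (hk c) x (Finset.mem_of_mem_insert_of_ne hxe hxn) hxc]
    · rw [Function.update_of_ne hpc] at hx ⊢
      have hxn : x ≠ I.n + 1 := fun h => notMem p hp (h ▸ hx)
      rcases (hmem e).1 he with rfl | ⟨he, heQ⟩ | ⟨d, rfl⟩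
      · simp at hxe
      · exact hT.free p hp x hx e he hxe
      · have hpd := eq_of_mem _ hp _ (hk d) x hx (Finset.mem_of_mem_insert_of_ne hxe hxn)
        subst hpd
        exact absurd ⟨rfl, fun h => hpc (by rw [← h])⟩ hpk
  · rintro p ⟨hp, hpk⟩ x hx
    have old : ∀ q ∈ S, ∀ x ∈ T q, omhcAssign A I' x = q.1 := fun q hq x hx =>
      (omhcAssign_extend A hI.empty_mem hQE (OMHCInstance.le_of_mem (hT.mem q hq) hx)).trans
        (hT.mono q hq x hx)
    by_cases hpc : p = (c, k)
    · rw [hpc, Function.update_self] at hx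
      rw [hpc]
      rcases Finset.mem_insert.1 hx with rfl | hx
      · rfl
      · exact old _ (hk c) x hx
    · rw [Function.update_of_ne hpc] at hx
      exact old p hp x hx
  · rintro p ⟨hp, -⟩ q ⟨hq, -⟩ hpq
    by_cases hpc : p = (c, k)
    · have hqc : q ≠ (c, k) := fun h => hpq (hpc.trans h.symm)
      rw [hpc, Function.update_self, Function.update_of_ne hqc, Finset.disjoint_insert_left]
      exact ⟨notMem q hq, hT.disj _ (hk c) q hq hqc.symm⟩
    · rw [Function.update_of_ne hpc]
      by_cases hqc : q = (c, k)
      · rw [hqc, Function.update_self, Finset.disjoint_insert_right]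
        exact ⟨notMem p hp, hT.disj p hp _ (hk c) hpc⟩
      · rw [Function.update_of_ne hqc]
        exact hT.disj p hp q hq hpq

/-- After `k` extensions one hyperedge with each index below `k` has grown by one node. -/
theorem exists_extend_iterate {m : ℕ} (A : OMHCAlg m) {I : OMHCInstance}
    (hI : AdversaryInstance m I) {T : Fin m × ℕ → Finset ℕ} {N : ℕ} {s : Fin m → ℕ}
    (hT : Extendable A I T {p | p.2 < N}) (hs : ∀ c, s c < m)
    (hcard : ∀ c, ∀ i < N, (T (c, i)).card = s c) (k : ℕ) (hk : k ≤ N) :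
    ∃ (I' : OMHCInstance) (T' : Fin m × ℕ → Finset ℕ) (g : ℕ → Fin m),
      AdversaryInstance m I' ∧ I'.n = I.n + k ∧
      Extendable A I' T' {p | p.2 < N ∧ (p.2 < k → p.1 = g p.2)} ∧
      (∀ c, ∀ i < N, k ≤ i → (T' (c, i)).card = s c) ∧
      (∀ i < k, (T' (g i, i)).card = s (g i) + 1) := by
  induction k with
  | zero =>
    refine ⟨I, T, fun i => omhcAssign A I i, hI, rfl, ?_, fun c i hi _ => hcard c i hi, by simp⟩
    simpa using hT
  | succ k ih =>
    obtain ⟨I', T', g, hI', hn, hT', hbase, hnew⟩ := ih (by omega)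
    obtain ⟨J, c, P, hJ, hJn, hP, hTJ⟩ := exists_extend A hI' hT' k
      (fun c => ⟨by simpa using hk, fun h => absurd h (lt_irrefl k)⟩)
      (fun c => by rw [hbase c k hk le_rfl]; exact hs c)
    refine ⟨J, Function.update T' (c, k) P, Function.update g k c, hJ, by omega, ?_, ?_, ?_⟩
    · convert hTJ using 1
      ext ⟨d, i⟩
      simp only [Set.mem_ofPred_eq, Set.mem_sdiff, not_and, not_not]
      rcases lt_trichotomy i k with h | rfl | h
      · rw [Function.update_of_ne h.ne]
        exact ⟨fun H => ⟨⟨H.1, fun _ => H.2 (by omega)⟩, fun h' => absurd h' h.ne⟩,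
          fun H => ⟨H.1.1, fun _ => H.1.2 h⟩⟩
      · rw [Function.update_self]
        exact ⟨fun H => ⟨⟨H.1, fun h' => absurd h' (lt_irrefl i)⟩, fun _ => H.2 (by omega)⟩,
          fun H => ⟨H.1.1, fun _ => H.2 rfl⟩⟩
      · exact ⟨fun H => ⟨⟨H.1, fun _ => by omega⟩, fun _ => by omega⟩,
          fun H => ⟨H.1.1, fun _ => by omega⟩⟩
    · intro d i hi hki
      rw [Function.update_of_ne (by simp; omega)]
      exact hbase d i hi (by omega)
    · intro i hi
      by_cases hik : i = k
      · subst hik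
        rw [Function.update_self, Function.update_self, hP, hbase c i hk le_rfl]
      · rw [Function.update_of_ne hik, Function.update_of_ne (by simp [hik])]
        exact hnew i (by omega)

theorem exists_injOn_of_le_card {N : ℕ} {F : Finset ℕ} (h : N ≤ F.card) :
    ∃ e : ℕ → ℕ, Set.InjOn e {i | i < N} ∧ ∀ i < N, e i ∈ F := by
  refine ⟨fun i => if hi : i < N then F.orderEmbOfFin rfl ⟨i, hi.trans_le h⟩ else 0, ?_, ?_⟩
  · intro i hi j hj hij
    simp only [Set.mem_ofPred_eq] at hi hj
    simpa [hi, hj] using hij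
  · intro i hi
    simp [hi]

/-- The adversary can force `N` monochromatic hyperedges of each color with total size profile
`k`, unless it has already forced one of size `m`. -/
theorem exists_profile {m : ℕ} (hm : 1 ≤ m) (A : OMHCAlg m) (k : ℕ) : ∀ N : ℕ,
    ∃ (I : OMHCInstance) (T : Fin m × ℕ → Finset ℕ) (s : Fin m → ℕ),
      AdversaryInstance m I ∧ I.n ≤ N * (3 * m) ^ k ∧ Extendable A I T {p | p.2 < N} ∧
      (∀ c, ∀ i < N, (T (c, i)).card = s c) ∧ (∀ c, s c ≤ m) ∧
      ((∃ c, s c = m) ∨ ∑ c, s c = k) := by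
  induction k with
  | zero =>
    intro N
    refine ⟨⟨0, {∅}, by simp⟩, fun _ => ∅, fun _ => 0, ⟨by simp, ?_, by simp, by simp⟩,
      by simp, ⟨by simp, by simp, by simp, by simp⟩, by simp, by simp, by simp⟩
    intro e he f hf x hx
    simp at he
    simp [he] at hx
  | succ k ih =>
    intro N
    obtain ⟨I, T, s, hI, hn, hT, hcard, hs, hsum⟩ := ih (2 * m * N)
    have hN : N ≤ m * N := Nat.le_mul_of_pos_left N hm
    have h2 : 2 * m * N = m * N + m * N := by ring
    have hpow : 1 ≤ (3 * m) ^ k := Nat.one_le_pow _ _ (by omega)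
    have hbound : I.n + m * N ≤ N * (3 * m) ^ (k + 1) := by
      have : m * N * 1 ≤ m * N * (3 * m) ^ k := Nat.mul_le_mul_left _ hpow
      calc I.n + m * N ≤ 2 * m * N * (3 * m) ^ k + m * N * (3 * m) ^ k := by omega
        _ = N * (3 * m) ^ (k + 1) := by ring
    by_cases hwin : ∃ c, s c = m
    · refine ⟨I, T, s, hI, by omega, ?_, fun c i hi => hcard c i (by omega), hs, Or.inl hwin⟩
      exact hT.comp (f := id) (fun p hp => by simp at hp ⊢; omega) (Set.injOn_id _)
        (fun _ _ => rfl)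
    · have hsum := hsum.resolve_left hwin
      have hlt : ∀ c, s c < m := fun c => lt_of_le_of_ne (hs c) fun h => hwin ⟨c, h⟩
      obtain ⟨I', T', g, hI', hn', hT', hbase, hnew⟩ :=
        exists_extend_iterate A hI hT hlt hcard (m * N) (by omega)
      obtain ⟨c, -, hc⟩ : ∃ c ∈ (Finset.univ : Finset (Fin m)),
          N ≤ ((Finset.range (m * N)).filter (fun i => g i = c)).card :=
        Finset.exists_le_card_fiber_of_mul_le_card_of_maps_to (by simp)
          ⟨⟨0, hm⟩, Finset.mem_univ _⟩ (by simp)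
      obtain ⟨e, hinj, he⟩ := exists_injOn_of_le_card hc
      simp only [Finset.mem_filter, Finset.mem_range] at he
      refine ⟨I', T' ∘ fun p => (p.1, if p.1 = c then e p.2 else m * N + p.2),
        Function.update s c (s c + 1), hI', by omega, hT'.comp ?_ ?_ (fun _ _ => rfl), ?_, ?_,
        Or.inr ?_⟩
      · rintro ⟨d, i⟩ hi
        simp only [Set.mem_ofPred_eq] at hi ⊢
        by_cases hd : d = c
        · simp only [hd, if_true]
          have := he i hi
          exact ⟨by omega, fun _ => this.2.symm⟩
        · simp only [hd, if_false]
          exact ⟨by omega, fun _ => by omega⟩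
      · rintro ⟨d, i⟩ hi ⟨d', j⟩ hj hij
        simp only [Prod.mk.injEq] at hij ⊢
        obtain ⟨rfl, hij⟩ := hij
        refine ⟨rfl, ?_⟩
        by_cases hd : d = c
        · simp only [hd, if_true] at hij
          exact hinj hi hj hij
        · simp only [hd, if_false] at hij
          omega
      · intro d i hi
        by_cases hd : d = c
        · subst hd
          have h1 := he i hi
          have h3 := hnew (e i) h1.1
          rw [h1.2] at h3
          simpa using h3
        · rw [Function.update_of_ne hd]
          simp only [Function.comp, hd, if_false]
          exact hbase d _ (by omega) (by omega)
      · intro d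
        by_cases hd : d = c
        · subst hd
          rw [Function.update_self]
          exact hlt d
        · rw [Function.update_of_ne hd]
          exact hs d
      · rw [Finset.sum_update_of_mem (Finset.mem_univ c), ← hsum,
          ← Finset.add_sum_erase _ s (Finset.mem_univ c), Finset.sdiff_singleton_eq_erase]
        ring

theorem pow_lt_tower5 {m : ℕ} (hm : 1 ≤ m) : (3 * m) ^ (m * m) < tower5 (2 * m + 1) := by
  set x := 2 * m + 1 with hx
  have hx1 : 1 < x := by omega
  have le_pow : ∀ y, y ≤ x ^ y := fun y => (Nat.lt_pow_self hx1).le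
  calc (3 * m) ^ (m * m) ≤ (x ^ 2) ^ (m * m) := by
        gcongr
        rw [hx]
        nlinarith
    _ = x ^ (2 * (m * m)) := by rw [← pow_mul]
    _ < x ^ x ^ 2 := by
        refine Nat.pow_lt_pow_right hx1 ?_
        rw [hx]
        nlinarith
    _ ≤ x ^ x ^ x := by
        gcongr <;> omega
    _ ≤ x ^ x ^ x ^ x := by
        gcongr <;> first | exact le_pow _ | omega
    _ ≤ tower5 x := by
        unfold tower5
        gcongr <;> first | exact le_pow _ | omega

theorem card_filter_le_omhcMakespan {m : ℕ} {I : OMHCInstance} (φ : ℕ → Fin m) {e : Finset ℕ}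
    (he : e ∈ I.E) (i : Fin m) :
    (e.filter (fun v => φ v = i)).card ≤ omhcMakespan m I φ :=
  (Finset.le_sup (f := fun i : Fin m => (e.filter (fun v => φ v = i)).card)
    (Finset.mem_univ i)).trans
    (Finset.le_sup (f := fun e => Finset.univ.sup fun i : Fin m =>
      (e.filter (fun v => φ v = i)).card) he)

theorem AdversaryInstance.omhcOPT_eq_one {m : ℕ} (hm : 1 ≤ m) {I : OMHCInstance}
    (hI : AdversaryInstance m I) (hne : ∃ e ∈ I.E, e.Nonempty) : omhcOPT m I = 1 := by
  obtain ⟨e, he, x, hx⟩ := hne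
  have hlow : ∀ φ : ℕ → Fin m, 1 ≤ omhcMakespan m I φ := fun φ =>
    (card_filter_le_omhcMakespan φ he (φ x)).trans' <|
      Finset.card_pos.2 ⟨x, Finset.mem_filter.2 ⟨hx, rfl⟩⟩
  obtain ⟨φ, hφ⟩ := hI.uniqueUp.exists_rainbow hm I.hE hI.card_edge_le
  have hup : omhcMakespan m I φ ≤ 1 := by
    refine Finset.sup_le fun f hf => Finset.sup_le fun i _ => Finset.card_le_one.2 ?_
    intro a ha b hb
    rw [Finset.mem_filter] at ha hb
    rcases lt_trichotomy a b with h | h | h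
    · exact absurd (ha.2.trans hb.2.symm) (hφ f hf a ha.1 b hb.1 h)
    · exact h
    · exact absurd (hb.2.trans ha.2.symm) (hφ f hf b hb.1 a ha.1 h)
  have hmem : omhcMakespan m I φ ∈ {v | ∃ φ : ℕ → Fin m, v = omhcMakespan m I φ} := ⟨φ, rfl⟩
  refine le_antisymm ((Nat.sInf_le hmem).trans hup) (le_csInf ⟨_, hmem⟩ ?_)
  rintro _ ⟨ψ, rfl⟩
  exact hlow ψ

theorem exists_forcing_instance {m : ℕ} (hm : 1 ≤ m) (A : OMHCAlg m) :
    ∃ I : OMHCInstance, IsHyperforest I.E ∧ I.n ≤ tower5 (2 * m + 1) ∧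
      I.E.card ≤ m * tower5 (2 * m + 1) ∧ (∀ e ∈ I.E, e.card ≤ m) ∧ omhcOPT m I = 1 ∧
      ∃ e ∈ I.E, e.card = m ∧ ∀ v ∈ e, ∀ w ∈ e, omhcAssign A I v = omhcAssign A I w := by
  obtain ⟨I, T, s, hI, hn, hT, hcard, hs, hsum⟩ := exists_profile hm A (m * m) 1
  obtain ⟨c, hc⟩ : ∃ c, s c = m := by
    refine hsum.elim id fun hsum => ⟨⟨0, hm⟩, ?_⟩
    have h : ∑ c, s c = ∑ _c : Fin m, m := by simp [hsum]
    exact (Finset.sum_eq_sum_iff_of_le fun c _ => hs c).1 h _ (Finset.mem_univ _)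
  have hp : (c, 0) ∈ {p : Fin m × ℕ | p.2 < 1} := Nat.one_pos
  have hTc : (T (c, 0)).card = m := (hcard c 0 Nat.one_pos).trans hc
  have hlt := pow_lt_tower5 hm
  rw [one_mul] at hn
  refine ⟨I, hI.uniqueUp.isHyperforest, by omega, ?_, hI.card_edge_le,
    hI.omhcOPT_eq_one hm ⟨_, hT.mem _ hp, Finset.card_pos.1 (by omega)⟩,
    _, hT.mem _ hp, hTc, fun v hv w hw => (hT.mono _ hp v hv).trans (hT.mono _ hp w hw).symm⟩
  have h1 := hI.card_le
  have h2 : tower5 (2 * m + 1) ≤ m * tower5 (2 * m + 1) := Nat.le_mul_of_pos_left _ hm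
  omega

/-- **Theorem.** For every `m ≥ 1`, every deterministic online algorithm for `OMHC(m)`
admits a hyperforest instance with at most `(2m+1)↑↑5` nodes, at most `m·((2m+1)↑↑5)`
hyperedges, all of size at most `m`, with offline optimum `1`, on which the algorithm's
coloring makes some hyperedge of size `m` monochromatic. In particular, for every `ε > 0`
there is no `(m-ε)`-competitive deterministic online algorithm for `OMHC(m)`, even restricted
to such hyperforests. -/
theorem omhc_no_better_than_m_competitive (m : ℕ) (hm : 1 ≤ m) :
    (∀ A : OMHCAlg m, ∃ I : OMHCInstance,
        IsHyperforest I.E ∧ I.n ≤ tower5 (2 * m + 1) ∧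
        I.E.card ≤ m * tower5 (2 * m + 1) ∧ (∀ e ∈ I.E, e.card ≤ m) ∧
        omhcOPT m I = 1 ∧
        ∃ e ∈ I.E, e.card = m ∧ ∀ v ∈ e, ∀ w ∈ e, omhcAssign A I v = omhcAssign A I w) ∧
      ∀ ε : ℝ, 0 < ε →
        ¬ ∃ A : OMHCAlg m, ∀ I : OMHCInstance,
            IsHyperforest I.E → I.n ≤ tower5 (2 * m + 1) →
            I.E.card ≤ m * tower5 (2 * m + 1) → (∀ e ∈ I.E, e.card ≤ m) →
            (omhcMakespan m I (omhcAssign A I) : ℝ) ≤ ((m : ℝ) - ε) * (omhcOPT m I : ℝ) := by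
  refine ⟨exists_forcing_instance hm, fun ε hε ⟨A, hA⟩ => ?_⟩
  obtain ⟨I, hf, hn, hE, hc, hopt, e, he, hem, hmono⟩ := exists_forcing_instance hm A
  have h := hA I hf hn hE hc
  obtain ⟨x, hx⟩ : e.Nonempty := Finset.card_pos.1 (by omega)
  have h1 := card_filter_le_omhcMakespan (omhcAssign A I) he (omhcAssign A I x)
  rw [Finset.filter_true_of_mem fun v hv => hmono v hv x hx, hem] at h1
  have h2 : (m : ℝ) ≤ omhcMakespan m I (omhcAssign A I) := by exact_mod_cast h1
  rw [hopt, Nat.cast_one, mul_one] at h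
  linarith
end

section
/- Consider deterministic online algorithms that color the nodes of a hypergraph H = ([n], E), revealed one node at a time (upon revelation of node j the sets e ∩ [j] for all e ∈ E are known), assigning each node irrevocably a color from ℕ. For every integer m ≥ 1 and every such deterministic online algorithm A, there exists a hyperforest H with at most (2m+1)↑↑5 nodes (where x↑↑5 = x^(x^(x^(x^x)))) such that A's coloring of H either leaves some hyperedge of size at least 2 monochromatic, or uses more than m distinct colors. -/
open Finset

/-- The coloring (with colors from `ℕ`) produced by an online hypergraph coloring
algorithm `A` on instance `I`, where node `j` only sees the partial hyperedges `e ∩ [j]`. -/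
def omhcAssignNat (A : ℕ → Finset (Finset ℕ) → ℕ) (I : OMHCInstance) : ℕ → ℕ :=
  fun j => A j (I.E.image (fun e => e ∩ Finset.Icc 1 j))

/-- The part visible at time `j` of the forest in which node `a` is joined to the later node `p a`
(whenever `a < p a`), together with the empty edge and all singletons, which hide the future. -/
def visibleEdges (p : ℕ → ℕ) (j : ℕ) : Finset (Finset ℕ) :=
  insert ∅ ((Icc 1 j).image singleton ∪
    ((Icc 1 j).filter (fun a => a < p a ∧ p a ≤ j)).image (fun a => {a, p a}))

lemma mem_visibleEdges {p : ℕ → ℕ} {j : ℕ} {e : Finset ℕ} :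
    e ∈ visibleEdges p j ↔ e = ∅ ∨ (∃ a, 1 ≤ a ∧ a ≤ j ∧ e = {a}) ∨
      ∃ a, 1 ≤ a ∧ a < p a ∧ p a ≤ j ∧ e = {a, p a} := by
  simp only [visibleEdges, mem_insert, mem_union, mem_image, mem_filter, mem_Icc]
  constructor
  · rintro (h | ⟨a, h, rfl⟩ | ⟨a, h, rfl⟩)
    · exact Or.inl h
    · exact Or.inr (Or.inl ⟨a, h.1, h.2, rfl⟩)
    · exact Or.inr (Or.inr ⟨a, h.1.1, h.2.1, h.2.2, rfl⟩)
  · rintro (h | ⟨a, h, h', rfl⟩ | ⟨a, h, h', h'', rfl⟩)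
    · exact Or.inl h
    · exact Or.inr (Or.inl ⟨a, ⟨h, h'⟩, rfl⟩)
    · exact Or.inr (Or.inr ⟨a, ⟨⟨h, by omega⟩, h', h''⟩, rfl⟩)

/-- If every node is a non-maximal element of at most one hyperedge, then there is no hypercycle. -/
lemma isHyperforest_of_unique_upper {E : Finset (Finset ℕ)}
    (h : ∀ e ∈ E, ∀ f ∈ E, ∀ x ∈ e, x ∈ f → (∃ y ∈ e, x < y) → (∃ y ∈ f, x < y) → e = f) :
    IsHyperforest E := by
  rintro ⟨l, v, e, hl, heE, hinj, hv⟩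
  obtain ⟨t, ht, hmin⟩ := exists_min_image (range l) v ⟨0, mem_range.2 hl⟩
  simp only [mem_range] at ht hmin
  have hl2 : l ≠ 1 := by
    rintro rfl
    simpa using (hv 0 one_pos).2.2
  obtain ⟨s, hs, hst, hne⟩ : ∃ s < l, (s + 1) % l = t ∧ s ≠ t := by
    rcases Nat.eq_zero_or_pos t with rfl | h0
    · exact ⟨l - 1, by omega, by rw [Nat.sub_add_cancel hl, Nat.mod_self], by omega⟩
    · exact ⟨t - 1, by omega, by rw [Nat.sub_add_cancel h0, Nat.mod_eq_of_lt ht], by omega⟩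
  obtain ⟨h1, h2, h3⟩ := hv s hs
  obtain ⟨h4, h5, h6⟩ := hv t ht
  rw [hst] at h2 h3
  refine hinj s hs t ht hne (h _ (heE s hs) _ (heE t ht) (v t) h2 h4 ⟨v s, h1, ?_⟩ ⟨_, h5, ?_⟩)
  · exact lt_of_le_of_ne (hmin s hs) (Ne.symm h3)
  · exact lt_of_le_of_ne (hmin _ (Nat.mod_lt _ hl)) h6

lemma isHyperforest_visibleEdges (p : ℕ → ℕ) (n : ℕ) : IsHyperforest (visibleEdges p n) := by
  have key : ∀ e ∈ visibleEdges p n, ∀ x ∈ e, (∃ y ∈ e, x < y) → e = {x, p x} := by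
    intro e he x hx hy
    obtain ⟨y, hy, hxy⟩ := hy
    rcases mem_visibleEdges.1 he with rfl | ⟨a, -, -, rfl⟩ | ⟨a, -, ha, -, rfl⟩
    · simp at hx
    · simp only [mem_singleton] at hx hy
      omega
    · simp only [mem_insert, mem_singleton] at hx hy
      have : x = a := by omega
      rw [this]
  refine isHyperforest_of_unique_upper fun e he f hf x hxe hxf h1 h2 => ?_
  rw [key e he x hxe h1, key f hf x hxf h2]

/-- The hyperforest on `n` nodes given by the parent function `p`. -/
def forestInstance (p : ℕ → ℕ) (n : ℕ) : OMHCInstance where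
  n := n
  E := visibleEdges p n
  hE := by
    intro e he x hx
    rw [mem_Icc]
    rcases mem_visibleEdges.1 he with rfl | ⟨a, h1, h2, rfl⟩ | ⟨a, h1, h2, h3, rfl⟩
    · simp at hx
    · simp only [mem_singleton] at hx
      omega
    · simp only [mem_insert, mem_singleton] at hx
      omega

lemma pair_inter_Icc {a b j : ℕ} (ha : 1 ≤ a) (hab : a < b) :
    ({a, b} : Finset ℕ) ∩ Icc 1 j = if b ≤ j then {a, b} else if a ≤ j then {a} else ∅ := by
  ext x
  split_ifs <;> simp only [mem_inter, mem_insert, mem_singleton, mem_Icc, notMem_empty, iff_false] <;> omega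

lemma singleton_inter_Icc {a j : ℕ} (ha : 1 ≤ a) :
    ({a} : Finset ℕ) ∩ Icc 1 j = if a ≤ j then {a} else ∅ := by
  ext x
  split_ifs <;> simp only [mem_inter, mem_singleton, mem_Icc, notMem_empty, iff_false] <;> omega

lemma image_inter_visibleEdges (p : ℕ → ℕ) {j n : ℕ} (hj : j ≤ n) :
    (visibleEdges p n).image (fun e => e ∩ Icc 1 j) = visibleEdges p j := by
  ext f
  rw [mem_image]
  constructor
  · rintro ⟨e, he, rfl⟩
    rw [mem_visibleEdges]
    rcases mem_visibleEdges.1 he with rfl | ⟨a, h1, h2, rfl⟩ | ⟨a, h1, h2, h3, rfl⟩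
    · simp
    · rw [singleton_inter_Icc h1]
      split_ifs with h
      · exact Or.inr (Or.inl ⟨a, h1, h, rfl⟩)
      · exact Or.inl rfl
    · rw [pair_inter_Icc h1 h2]
      split_ifs with h h'
      · exact Or.inr (Or.inr ⟨a, h1, h2, h, rfl⟩)
      · exact Or.inr (Or.inl ⟨a, h1, h', rfl⟩)
      · exact Or.inl rfl
  · intro hf
    refine ⟨f, ?_, inter_eq_left.2 ((forestInstance p j).hE f hf)⟩
    rw [mem_visibleEdges] at hf ⊢
    rcases hf with h | ⟨a, h1, h2, h⟩ | ⟨a, h1, h2, h3, h⟩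
    · exact Or.inl h
    · exact Or.inr (Or.inl ⟨a, h1, h2.trans hj, h⟩)
    · exact Or.inr (Or.inr ⟨a, h1, h2, h3.trans hj, h⟩)

/-- The color that `A` gives to node `j` of the forest with parent function `p`. -/
def forestColor (A : ℕ → Finset (Finset ℕ) → ℕ) (p : ℕ → ℕ) (j : ℕ) : ℕ :=
  A j (visibleEdges p j)

lemma omhcAssignNat_forestInstance (A : ℕ → Finset (Finset ℕ) → ℕ) (p : ℕ → ℕ) {j n : ℕ}
    (hj : j ≤ n) : omhcAssignNat A (forestInstance p n) j = forestColor A p j :=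
  congrArg (A j) (image_inter_visibleEdges p hj)

/-- Colors do not change when roots later receive new parents. -/
lemma forestColor_congr (A : ℕ → Finset (Finset ℕ) → ℕ) {p q : ℕ → ℕ} {n j : ℕ}
    (h : ∀ a ≤ n, q a = p a ∨ (p a = 0 ∧ n < q a)) (hj : j ≤ n) :
    forestColor A q j = forestColor A p j := by
  refine congrArg (A j) ?_
  ext e
  rw [mem_visibleEdges, mem_visibleEdges]
  refine or_congr_right (or_congr_right (exists_congr fun a => ?_))
  constructor
  · rintro ⟨h1, h2, h3, h4⟩
    rcases h a (by omega) with h5 | h5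
    · rw [← h5]
      exact ⟨h1, h2, h3, h4⟩
    · omega
  · rintro ⟨h1, h2, h3, h4⟩
    rcases h a (by omega) with h5 | h5
    · rw [h5]
      exact ⟨h1, h2, h3, h4⟩
    · omega

/-- Against an algorithm that properly colors all forests on at most `B` nodes, every forest can be
extended by fewer than `2 ^ k` nodes, among them a set of roots carrying `k` distinct colors. -/
lemma exists_roots_card_colors (A : ℕ → Finset (Finset ℕ) → ℕ) {B : ℕ}
    (hA : ∀ p : ℕ → ℕ, ∀ a, 1 ≤ a → a < p a → p a ≤ B → forestColor A p a ≠ forestColor A p (p a))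
    (k : ℕ) : ∀ (n : ℕ) (p : ℕ → ℕ), n + 2 ^ k ≤ B + 1 →
      ∃ (n' : ℕ) (q : ℕ → ℕ) (R : Finset ℕ), n ≤ n' ∧ n' + 1 ≤ n + 2 ^ k ∧
        (∀ a ≤ n, q a = p a) ∧ (∀ a ∈ R, n < a ∧ a ≤ n' ∧ q a = 0) ∧
        (R.image (forestColor A q)).card = k := by
  induction k with
  | zero => exact fun n p _ => ⟨n, p, ∅, by simp⟩
  | succ k ih =>
    intro n p hB
    rw [pow_succ] at hB ⊢
    obtain ⟨n₁, q₁, R₁, hn₁, hN₁, hq₁, hR₁, hc₁⟩ := ih n p (by omega)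
    obtain ⟨n₂, q₂, R₂, hn₂, hN₂, hq₂, hR₂, hc₂⟩ := ih n₁ q₁ (by omega)
    have himg : R₁.image (forestColor A q₂) = R₁.image (forestColor A q₁) :=
      image_congr fun a ha =>
        forestColor_congr A (fun b hb => Or.inl (hq₂ b hb)) (hR₁ a ha).2.1
    by_cases hnew : R₂.image (forestColor A q₂) ⊆ R₁.image (forestColor A q₂)
    · have heq : R₂.image (forestColor A q₂) = R₁.image (forestColor A q₂) :=
        eq_of_subset_of_card_le hnew (by rw [himg, hc₁, hc₂])
      let q : ℕ → ℕ := fun a => if a ∈ R₂ then n₂ + 1 else if a = n₂ + 1 then 0 else q₂ a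
      have hcol : ∀ j ≤ n₂, forestColor A q j = forestColor A q₂ j := by
        intro j hj
        refine forestColor_congr A (fun a ha => ?_) hj
        by_cases haR : a ∈ R₂
        · exact Or.inr ⟨(hR₂ a haR).2.2, by simp [q, haR]⟩
        · exact Or.inl (by simp only [q, if_neg haR]; rw [if_neg (by omega)])
      have hlow : ∀ a ≤ n₁, q a = q₁ a := by
        intro a ha
        have haR : a ∉ R₂ := fun h => by have := (hR₂ a h).1; omega
        simp only [q, if_neg haR]
        rw [if_neg (by omega), hq₂ a ha]
      have himg' : R₁.image (forestColor A q) = R₁.image (forestColor A q₂) :=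
        image_congr fun a ha => hcol a ((hR₁ a ha).2.1.trans hn₂)
      have hu : forestColor A q (n₂ + 1) ∉ R₁.image (forestColor A q) := by
        rw [himg', ← heq, mem_image]
        rintro ⟨w, hw, hcw⟩
        have hqw : q w = n₂ + 1 := by simp [q, hw]
        have hwb := hR₂ w hw
        refine hA q w (by omega) (by omega) (by omega) ?_
        rw [hqw, hcol w hwb.2.1, hcw]
      refine ⟨n₂ + 1, q, insert (n₂ + 1) R₁, by omega, by omega, ?_, ?_, ?_⟩
      · intro a ha
        rw [hlow a (ha.trans hn₁), hq₁ a ha]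
      · intro a ha
        rcases mem_insert.1 ha with rfl | ha
        · have hnR : n₂ + 1 ∉ R₂ := fun h => by have := (hR₂ _ h).2.1; omega
          exact ⟨by omega, le_rfl, by simp [q, hnR]⟩
        · have h := hR₁ a ha
          exact ⟨h.1, by omega, by rw [hlow a h.2.1, h.2.2]⟩
      · rw [image_insert, card_insert_of_notMem hu, himg', himg, hc₁]
    · obtain ⟨c, hc, hcn⟩ := not_subset.1 hnew
      obtain ⟨w, hw, rfl⟩ := mem_image.1 hc
      refine ⟨n₂, q₂, insert w R₁, by omega, by omega, ?_, ?_, ?_⟩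
      · intro a ha
        rw [hq₂ a (ha.trans hn₁), hq₁ a ha]
      · intro a ha
        rcases mem_insert.1 ha with rfl | ha
        · have h := hR₂ a hw
          exact ⟨by omega, h.2⟩
        · have h := hR₁ a ha
          exact ⟨h.1, by omega, by rw [hq₂ a h.2.1, h.2.2]⟩
      · rw [image_insert, card_insert_of_notMem hcn, himg, hc₁]

lemma two_pow_succ_le_tower5 {m : ℕ} (hm : 1 ≤ m) : 2 ^ (m + 1) ≤ tower5 (2 * m + 1) := by
  have hx : 1 < 2 * m + 1 := by omega
  have h1 : m + 1 ≤ (2 * m + 1) ^ (2 * m + 1) ^ (2 * m + 1) ^ (2 * m + 1) :=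
    calc m + 1 ≤ 2 * m + 1 := by omega
      _ ≤ (2 * m + 1) ^ (2 * m + 1) := (Nat.lt_pow_self hx).le
      _ ≤ _ := (Nat.lt_pow_self hx).le
      _ ≤ _ := (Nat.lt_pow_self hx).le
  exact (Nat.pow_le_pow_left (by omega) _).trans (Nat.pow_le_pow_right (by omega) h1)

/-- **Corollary.** For every `m ≥ 1` and every deterministic online hypergraph coloring
algorithm (with colors from `ℕ`), there is a hyperforest with at most `(2m+1)↑↑5` nodes on
which the algorithm either leaves some hyperedge of size at least `2` monochromatic, or uses
more than `m` distinct colors. Hence online hypergraph coloring of hypertrees with `n` nodes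
requires `Ω(slog₅ n)` colors, even when partial hyperedges are revealed. -/
theorem online_hypergraph_coloring_superlog_lower_bound (m : ℕ) (hm : 1 ≤ m)
    (A : ℕ → Finset (Finset ℕ) → ℕ) :
    ∃ I : OMHCInstance, IsHyperforest I.E ∧ I.n ≤ tower5 (2 * m + 1) ∧
      ((∃ e ∈ I.E, 2 ≤ e.card ∧
          ∀ v ∈ e, ∀ w ∈ e, omhcAssignNat A I v = omhcAssignNat A I w) ∨
        m < ((Finset.Icc 1 I.n).image (omhcAssignNat A I)).card) := by
  by_contra! hcon
  have hA : ∀ p : ℕ → ℕ, ∀ a, 1 ≤ a → a < p a → p a ≤ tower5 (2 * m + 1) →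
      forestColor A p a ≠ forestColor A p (p a) := by
    intro p a h1 h2 h3 h
    have hedge : ({a, p a} : Finset ℕ) ∈ visibleEdges p (p a) :=
      mem_visibleEdges.2 (Or.inr (Or.inr ⟨a, h1, h2, le_rfl, rfl⟩))
    obtain ⟨v, hv, w, hw, hvw⟩ :=
      (hcon (forestInstance p (p a)) (isHyperforest_visibleEdges p (p a)) h3).1 _ hedge
        (card_pair h2.ne).ge
    have hcol : ∀ x ∈ ({a, p a} : Finset ℕ),
        omhcAssignNat A (forestInstance p (p a)) x = forestColor A p a := by
      intro x hx
      rcases mem_insert.1 hx with rfl | hx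
      · exact omhcAssignNat_forestInstance A p h2.le
      · rw [mem_singleton.1 hx, omhcAssignNat_forestInstance A p le_rfl, h]
    exact hvw ((hcol v hv).trans (hcol w hw).symm)
  have hB := two_pow_succ_le_tower5 hm
  obtain ⟨n, q, R, -, hn, -, hR, hc⟩ := exists_roots_card_colors A hA (m + 1) 0 0 (by omega)
  have hle := (hcon (forestInstance q n) (isHyperforest_visibleEdges q n)
    (show n ≤ _ by omega)).2
  have hsub : R.image (forestColor A q) ⊆
      (Icc 1 n).image (omhcAssignNat A (forestInstance q n)) := by
    intro c hc
    obtain ⟨a, ha, rfl⟩ := mem_image.1 hc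
    have h := hR a ha
    exact mem_image.2 ⟨a, mem_Icc.2 ⟨h.1, h.2.1⟩, omhcAssignNat_forestInstance A q h.2.1⟩
  have hcard := (card_le_card hsub).trans hle
  omega
end

section
/- For every integer m ≥ 1 there exists an integer K_m such that for every K ≥ K_m and every deterministic online algorithm A for OMSS(m,K), there exists an instance I with unit processing times (p_j = 1 for all j) and |S_k| ≤ m for every scenario k ∈ [K], such that the makespan of A's assignment on I is at least m·OPT(I). In particular, for every ε > 0 there is no (m−ε)-competitive deterministic online algorithm for OMSS(m,K) when K ≥ K_m, even restricted to such instances. -/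
open Finset

/-- An instance of Online Makespan Scheduling under Scenarios with `K` scenarios:
`n` jobs `1,…,n`, nonnegative processing times `p`, and scenarios `S k ⊆ {1,…,n}`. -/
structure OMSSInstance (K : ℕ) where
  n : ℕ
  p : ℕ → ℝ
  hp : ∀ j, 0 ≤ p j
  S : Fin K → Finset ℕ
  hS : ∀ k, S k ⊆ Finset.Icc 1 n

/-- A deterministic online algorithm for `OMSS(m,K)`: the machine for job `j` is a
function only of `j`, the processing times revealed so far, and the partial scenarios. -/
abbrev OnlineAlg (m K : ℕ) := ℕ → (ℕ → ℝ) → (Fin K → Finset ℕ) → Fin m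

/-- The assignment produced by online algorithm `A` on instance `I`:
for job `j` the algorithm only sees `p_1,…,p_j` and `S_k ∩ [j]`. -/
noncomputable def algAssign {m K : ℕ} (A : OnlineAlg m K) (I : OMSSInstance K) : ℕ → Fin m :=
  fun j => A j (fun j' => if j' ≤ j then I.p j' else 0) (fun k => I.S k ∩ Finset.Icc 1 j)

/-- Load of machine `i` in scenario `k` under assignment `τ`. -/
noncomputable def load {m K : ℕ} (I : OMSSInstance K) (τ : ℕ → Fin m) (i : Fin m)
    (k : Fin K) : ℝ :=
  ∑ j ∈ (I.S k).filter (fun j => τ j = i), I.p j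

/-- Makespan of an assignment: the largest load of a machine in a scenario. -/
noncomputable def mkspan {m K : ℕ} (I : OMSSInstance K) (τ : ℕ → Fin m) : ℝ :=
  sSup {x | ∃ k : Fin K, ∃ i : Fin m, x = load I τ i k}

/-- Offline optimum makespan over all assignments to `m` machines. -/
noncomputable def OPT (m : ℕ) {K : ℕ} (I : OMSSInstance K) : ℝ :=
  sInf {x | ∃ τ : ℕ → Fin m, x = mkspan I τ}

/-- The pebble game behind the lower bound, on the counts `cnt c s` of live scenarios that so far
contain exactly `s` jobs, all on machine `c`. The adversary releases a job belonging to one live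
scenario for each machine; only the scenario of the machine chosen by the algorithm stays live, with
one more job. The adversary wins once some live scenario has `m` jobs. -/
inductive AdversaryWins {m : ℕ} : (Fin m → ℕ → ℕ) → Prop
  | full (cnt : Fin m → ℕ → ℕ) (c : Fin m) : 0 < cnt c m → AdversaryWins cnt
  | play (cnt : Fin m → ℕ → ℕ) (s : Fin m → ℕ) : (∀ c, s c < m) → (∀ c, 0 < cnt c (s c)) →
      (∀ c₀, AdversaryWins (fun c r => cnt c r - (if r = s c then 1 else 0) +
        (if c = c₀ ∧ r = s c₀ + 1 then 1 else 0))) → AdversaryWins cnt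

theorem AdversaryWins.of_upgrade {m : ℕ} (hm : 1 ≤ m) (s : Fin m → ℕ) (hs : ∀ c, s c < m) (N : ℕ)
    (hN : ∀ (c₀ : Fin m) (cnt : Fin m → ℕ → ℕ), (∀ c, c ≠ c₀ → N ≤ cnt c (s c)) →
      N ≤ cnt c₀ (s c₀ + 1) → AdversaryWins cnt) (r : ℕ) :
    ∀ cnt : Fin m → ℕ → ℕ, (∀ c, r + N ≤ cnt c (s c)) →
      ∑ c, (N - cnt c (s c + 1)) ≤ r → AdversaryWins cnt := by
  induction r with
  | zero =>
    intro cnt h hr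
    have h0 := (Finset.sum_eq_zero_iff.mp (Nat.le_zero.mp hr)) ⟨0, hm⟩ (Finset.mem_univ _)
    exact hN ⟨0, hm⟩ cnt (fun c _ => by have := h c; omega) (by omega)
  | succ r ih =>
    intro cnt h hr
    by_cases hc : ∃ c₀, N ≤ cnt c₀ (s c₀ + 1)
    · obtain ⟨c₀, hc⟩ := hc
      exact hN c₀ cnt (fun c _ => by have := h c; omega) hc
    push Not at hc
    refine .play cnt s hs (fun c => by have := h c; omega) fun c₀ => ih _ (fun c => ?_) ?_
    · have := h c
      simp only [if_true]
      split_ifs <;> omega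
    · refine Nat.le_of_lt_succ (lt_of_lt_of_le ?_ hr)
      refine Finset.sum_lt_sum (fun c _ => ?_) ⟨c₀, Finset.mem_univ _, ?_⟩
      · simp only [Nat.succ_ne_self, if_false]
        split_ifs <;> omega
      · have := hc c₀
        simp
        omega

theorem AdversaryWins.of_le_counts {m : ℕ} (hm : 1 ≤ m) (d : ℕ) :
    ∀ s : Fin m → ℕ, (∀ c, s c ≤ m) → ∑ c, (m - s c) ≤ d →
      ∃ N : ℕ, ∀ cnt : Fin m → ℕ → ℕ, (∀ c, N ≤ cnt c (s c)) → AdversaryWins cnt := by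
  induction d with
  | zero =>
    intro s hs h
    have h0 := (Finset.sum_eq_zero_iff.mp (Nat.le_zero.mp h)) ⟨0, hm⟩ (Finset.mem_univ _)
    have h1 : s ⟨0, hm⟩ = m := by have := hs ⟨0, hm⟩; omega
    refine ⟨1, fun cnt hc => .full cnt ⟨0, hm⟩ ?_⟩
    have := hc ⟨0, hm⟩
    rw [h1] at this
    omega
  | succ d ih =>
    intro s hs h
    by_cases hc : ∃ c, s c = m
    · obtain ⟨c, hc⟩ := hc
      refine ⟨1, fun cnt hcnt => .full cnt c ?_⟩
      have := hcnt c
      rw [hc] at this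
      omega
    push Not at hc
    have hlt : ∀ c, s c < m := fun c => lt_of_le_of_ne (hs c) (hc c)
    have key : ∀ c₀ : Fin m, ∃ N : ℕ, ∀ cnt : Fin m → ℕ → ℕ,
        (∀ c, N ≤ cnt c (Function.update s c₀ (s c₀ + 1) c)) → AdversaryWins cnt := by
      intro c₀
      refine ih _ (fun c => ?_) (Nat.le_of_lt_succ (lt_of_lt_of_le ?_ h))
      · rcases eq_or_ne c c₀ with rfl | hne
        · simpa using hlt c
        · simpa [hne] using hs c
      · refine Finset.sum_lt_sum (fun c _ => ?_) ⟨c₀, Finset.mem_univ _, ?_⟩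
        · rcases eq_or_ne c c₀ with rfl | hne
          · simp
            omega
          · simp [hne]
        · have := hlt c₀
          simp
          omega
    choose N hN using key
    have hle : ∀ c, N c ≤ ∑ c, N c := fun c =>
      Finset.single_le_sum (fun _ _ => Nat.zero_le _) (Finset.mem_univ c)
    refine ⟨m * (∑ c, N c) + ∑ c, N c, fun cnt hcnt =>
      AdversaryWins.of_upgrade hm s hlt (∑ c, N c) (fun c₀ cnt h1 h2 => ?_) _ cnt hcnt ?_⟩
    · refine hN c₀ cnt fun c => (hle c₀).trans ?_
      rcases eq_or_ne c c₀ with rfl | hne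
      · simpa using h2
      · simpa [hne] using h1 c hne
    · calc ∑ c, (∑ c, N c - cnt c (s c + 1)) ≤ ∑ _c : Fin m, ∑ c, N c :=
            Finset.sum_le_sum fun c _ => Nat.sub_le _ _
        _ = m * ∑ c, N c := by simp

/-- The machine given to job `j` by `A` on unit processing times and scenarios `S`. -/
noncomputable def unitAssign {m K : ℕ} (A : OnlineAlg m K) (S : Fin K → Finset ℕ) (j : ℕ) : Fin m :=
  A j (fun j' => if j' ≤ j then 1 else 0) (fun k => S k ∩ Finset.Icc 1 j)

/-- A position reached by the adversary after `n` unit jobs: `lab k = some (c, s)` marks scenario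
`k` as live, with `s` jobs, all put on machine `c` by `A`. Offline, the jobs can be assigned
injectively on every scenario, while avoiding on each live scenario any prescribed set of machines
that leaves enough room. -/
structure IsPosition {m K : ℕ} (A : OnlineAlg m K) (n : ℕ) (S : Fin K → Finset ℕ)
    (lab : Fin K → Option (Fin m × ℕ)) : Prop where
  subset : ∀ k, S k ⊆ Finset.Icc 1 n
  card_le : ∀ k, (S k).card ≤ m
  live : ∀ k c s, lab k = some (c, s) → (S k).card = s ∧ ∀ j ∈ S k, unitAssign A S j = c
  flexible : ∀ F : Fin K → Finset (Fin m), (∀ k, lab k ≠ none → (F k).card + (S k).card ≤ m) →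
    ∃ τ : ℕ → Fin m, (∀ k, Set.InjOn τ (S k)) ∧ ∀ k, lab k ≠ none → ∀ j ∈ S k, τ j ∉ F k

open Classical in
/-- Labels after a job in the scenarios `t` has been put on machine `c₀`. -/
noncomputable def stepLabel {m K : ℕ} (lab : Fin K → Option (Fin m × ℕ)) (t : Fin m → Fin K)
    (s : Fin m → ℕ) (c₀ : Fin m) (k : Fin K) : Option (Fin m × ℕ) :=
  if k = t c₀ then some (c₀, s c₀ + 1) else if k ∈ Set.range t then none else lab k

open Classical in
theorem IsPosition.step {m K : ℕ} {A : OnlineAlg m K} {n : ℕ} {S : Fin K → Finset ℕ}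
    {lab : Fin K → Option (Fin m × ℕ)} (h : IsPosition A n S lab) (t : Fin m → Fin K)
    (s : Fin m → ℕ) (hs : ∀ c, s c < m) (ht : ∀ c, lab (t c) = some (c, s c)) :
    ∃ S' c₀, IsPosition A (n + 1) S' (stepLabel lab t s c₀) := by
  set S' : Fin K → Finset ℕ := fun k => if k ∈ Set.range t then insert (n + 1) (S k) else S k
    with hS'
  have hin : ∀ k, k ∈ Set.range t → S' k = insert (n + 1) (S k) := fun k hk => if_pos hk
  have hout : ∀ k, k ∉ Set.range t → S' k = S k := fun k hk => if_neg hk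
  have hle : ∀ k, ∀ j ∈ S k, j ≤ n := fun k j hj => (Finset.mem_Icc.mp (h.subset k hj)).2
  have hnew : ∀ k, n + 1 ∉ S k := fun k hk => by have := hle k _ hk; omega
  have hassign : ∀ j ≤ n, unitAssign A S' j = unitAssign A S j := by
    intro j hj
    unfold unitAssign
    congr 1
    funext k
    by_cases hk : k ∈ Set.range t
    · rw [hin k hk, Finset.insert_inter_of_notMem]
      simp only [Finset.mem_Icc]
      omega
    · rw [hout k hk]
  have hcard : ∀ c, (S (t c)).card = s c := fun c => (h.live _ _ _ (ht c)).1
  set c₀ := unitAssign A S' (n + 1) with hc₀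
  refine ⟨S', c₀, ?_, ?_, ?_, ?_⟩
  · intro k j hj
    have hj' : j = n + 1 ∨ j ∈ S k := by
      by_cases hk : k ∈ Set.range t
      · simpa [hin k hk] using hj
      · exact .inr (by simpa [hout k hk] using hj)
    rcases hj' with rfl | hj'
    · simp
    · have := Finset.mem_Icc.mp (h.subset k hj')
      simp only [Finset.mem_Icc]
      omega
  · intro k
    by_cases hk : k ∈ Set.range t
    · rw [hin k hk, Finset.card_insert_of_notMem (hnew k)]
      obtain ⟨c, rfl⟩ := hk
      rw [hcard]
      exact hs c
    · rw [hout k hk]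
      exact h.card_le k
  · intro k c r hk
    unfold stepLabel at hk
    split_ifs at hk with h1 h2
    · simp only [Option.some.injEq, Prod.mk.injEq] at hk
      obtain ⟨rfl, rfl⟩ := hk
      subst h1
      rw [hin _ ⟨_, rfl⟩, Finset.card_insert_of_notMem (hnew _), hcard]
      refine ⟨rfl, fun j hj => ?_⟩
      rcases Finset.mem_insert.mp hj with rfl | hj
      · rfl
      · rw [hassign j (hle _ j hj)]
        exact (h.live _ _ _ (ht c₀)).2 j hj
    · rw [hout k h2]
      refine ⟨(h.live k c r hk).1, fun j hj => ?_⟩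
      rw [hassign j (hle _ j hj)]
      exact (h.live k c r hk).2 j hj
  · intro F hF
    have hF0 := hF (t c₀) (by simp [stepLabel])
    rw [hin _ ⟨_, rfl⟩, Finset.card_insert_of_notMem (hnew _)] at hF0
    obtain ⟨b, hb⟩ : ∃ b, b ∉ F (t c₀) := by
      by_contra! hall
      have : F (t c₀) = Finset.univ := Finset.eq_univ_iff_forall.mpr hall
      rw [this, Finset.card_univ, Fintype.card_fin] at hF0
      omega
    obtain ⟨τ, hinj, havoid⟩ := h.flexible
      (fun k => if k = t c₀ then insert b (F k) else if k ∈ Set.range t then {b} else F k) (by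
        intro k hk
        split_ifs with h1 h2
        · subst h1
          rw [Finset.card_insert_of_notMem hb]
          omega
        · obtain ⟨c, rfl⟩ := h2
          have := hs c
          rw [hcard, Finset.card_singleton]
          omega
        · have := hF k (by simpa only [stepLabel, h1, h2, if_false] using hk)
          rwa [hout k h2] at this)
    have hb' : ∀ k ∈ Set.range t, ∀ j ∈ S k, τ j ≠ b := by
      intro k hk j hj
      have hlive : lab k ≠ none := by
        obtain ⟨c, rfl⟩ := hk
        simp [ht]
      have := havoid k hlive j hj
      split_ifs at this with h1
      · exact fun hh => this (by simp [hh])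
      · simpa using this
    have hold : ∀ k, ∀ j ∈ S k, Function.update τ (n + 1) b j = τ j := fun k j hj =>
      Function.update_of_ne (by have := hle k j hj; omega) _ _
    refine ⟨Function.update τ (n + 1) b, fun k => ?_, fun k hk j hj => ?_⟩
    · have hinj' : Set.InjOn (Function.update τ (n + 1) b) (S k) :=
        (hinj k).congr fun j hj => (hold k j hj).symm
      by_cases hk : k ∈ Set.range t
      · rw [hin k hk, Finset.coe_insert, Set.injOn_insert (by simpa using hnew k)]
        refine ⟨hinj', ?_⟩
        rintro ⟨j, hj, hjb⟩
        rw [hold k j hj, Function.update_self] at hjb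
        exact hb' k hk j hj hjb
      · rwa [hout k hk]
    · unfold stepLabel at hk
      split_ifs at hk with h1 h2
      · rw [hin k ⟨c₀, h1.symm⟩] at hj
        rcases Finset.mem_insert.mp hj with rfl | hj
        · rw [Function.update_self, h1]
          exact hb
        · rw [hold k j hj]
          have := havoid k (by rw [h1, ht]; simp) j hj
          rw [if_pos h1] at this
          exact fun hh => this (Finset.mem_insert_of_mem hh)
      · exact absurd rfl hk
      · rw [hout k h2] at hj
        rw [hold k j hj]
        have := havoid k hk j hj
        rwa [if_neg h1, if_neg h2] at this

theorem le_card_stepLabel {m K : ℕ} {lab : Fin K → Option (Fin m × ℕ)} {t : Fin m → Fin K}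
    {s : Fin m → ℕ} (ht : ∀ c, lab (t c) = some (c, s c)) (c₀ c : Fin m) (r : ℕ) :
    (Finset.univ.filter fun k => lab k = some (c, r)).card - (if r = s c then 1 else 0) +
        (if c = c₀ ∧ r = s c₀ + 1 then 1 else 0) ≤
      (Finset.univ.filter fun k => stepLabel lab t s c₀ k = some (c, r)).card := by
  have hkeep : ∀ k, lab k = some (c, r) → k ≠ t c → stepLabel lab t s c₀ k = some (c, r) := by
    intro k hk hne
    have hk' : k ∉ Set.range t := by
      rintro ⟨d, rfl⟩
      rw [ht, Option.some.injEq, Prod.mk.injEq] at hk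
      exact hne (by rw [hk.1])
    have hk0 : k ≠ t c₀ := fun hh => hk' ⟨c₀, hh.symm⟩
    simp only [stepLabel, hk0, hk', if_false, hk]
  by_cases h1 : c = c₀ ∧ r = s c₀ + 1
  · obtain ⟨rfl, rfl⟩ := h1
    have hnot : t c ∉ Finset.univ.filter fun k => lab k = some (c, s c + 1) := by simp [ht]
    simp only [Nat.succ_ne_self, if_false, and_self, if_true, Nat.sub_zero]
    rw [← Finset.card_insert_of_notMem hnot]
    refine Finset.card_le_card fun k hk => ?_
    simp only [Finset.mem_filter, Finset.mem_univ, true_and]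
    rcases Finset.mem_insert.mp hk with rfl | hk
    · simp [stepLabel]
    · exact hkeep k (Finset.mem_filter.mp hk).2 fun hh => hnot (hh ▸ hk)
  rw [if_neg h1, Nat.add_zero]
  by_cases h2 : r = s c
  · rw [if_pos h2, ← Finset.card_erase_of_mem (a := t c) (by simp [ht, h2])]
    refine Finset.card_le_card fun k hk => ?_
    simp only [Finset.mem_erase, Finset.mem_filter, Finset.mem_univ, true_and] at hk ⊢
    exact hkeep k hk.2 hk.1
  · rw [if_neg h2, Nat.sub_zero]
    refine Finset.card_le_card fun k hk => ?_
    simp only [Finset.mem_filter, Finset.mem_univ, true_and] at hk ⊢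
    refine hkeep k hk fun hh => h2 ?_
    rw [hh, ht, Option.some.injEq, Prod.mk.injEq] at hk
    exact hk.2.symm

theorem AdversaryWins.exists_full {m K : ℕ} {A : OnlineAlg m K} {cnt : Fin m → ℕ → ℕ}
    (hw : AdversaryWins cnt) : ∀ {n : ℕ} {S : Fin K → Finset ℕ} {lab : Fin K → Option (Fin m × ℕ)},
    IsPosition A n S lab →
    (∀ c r, cnt c r ≤ (Finset.univ.filter fun k => lab k = some (c, r)).card) →
    ∃ n' S' lab', IsPosition A n' S' lab' ∧ ∃ k c, lab' k = some (c, m) := by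
  induction hw with
  | full cnt c hc =>
    intro n S lab h hcnt
    obtain ⟨k, hk⟩ := Finset.card_pos.mp (hc.trans_le (hcnt c m))
    exact ⟨n, S, lab, h, k, c, (Finset.mem_filter.mp hk).2⟩
  | play cnt s hs hpos _ ih =>
    intro n S lab h hcnt
    have hex : ∀ c, ∃ k, lab k = some (c, s c) := fun c => by
      obtain ⟨k, hk⟩ := Finset.card_pos.mp ((hpos c).trans_le (hcnt c (s c)))
      exact ⟨k, (Finset.mem_filter.mp hk).2⟩
    choose t ht using hex
    obtain ⟨S', c₀, h'⟩ := h.step t s hs ht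
    refine ih c₀ h' fun c r => le_trans ?_ (le_card_stepLabel ht c₀ c r)
    exact Nat.add_le_add_right (Nat.sub_le_sub_right (hcnt c r) _) _

theorem isPosition_initial {m K : ℕ} (hm : 1 ≤ m) (A : OnlineAlg m K) :
    IsPosition A 0 (fun _ => ∅) (fun k => some (⟨k % m, Nat.mod_lt _ hm⟩, 0)) where
  subset k := Finset.empty_subset _
  card_le k := by simp
  live k c s h := by
    simp only [Option.some.injEq, Prod.mk.injEq] at h
    simp [h.2]
  flexible F _ := ⟨fun _ => ⟨0, hm⟩, by simp, by simp⟩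

theorem le_card_filter_mod {m K N : ℕ} (hm : 1 ≤ m) (hK : m * N ≤ K) (c : Fin m) :
    N ≤ (Finset.univ.filter fun k : Fin K =>
      some ((⟨k % m, Nat.mod_lt _ hm⟩ : Fin m), 0) = some (c, 0)).card := by
  have hlt : ∀ i : Fin N, m * i + c < K := fun i => by
    have h1 : m * ((i : ℕ) + 1) ≤ m * N := Nat.mul_le_mul_left _ i.2
    have h2 := c.2
    rw [Nat.mul_add] at h1
    omega
  have hinj : Function.Injective fun i : Fin N => (⟨m * i + c, hlt i⟩ : Fin K) := by
    intro i j hij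
    have h1 : m * (i : ℕ) + c = m * j + c := congrArg Fin.val hij
    exact Fin.ext (Nat.eq_of_mul_eq_mul_left hm (Nat.add_right_cancel h1))
  calc N = (Finset.univ.image fun i : Fin N => (⟨m * i + c, hlt i⟩ : Fin K)).card := by
        rw [Finset.card_image_of_injective _ hinj, Finset.card_univ, Fintype.card_fin]
    _ ≤ _ := by
        refine Finset.card_le_card fun k hk => ?_
        obtain ⟨i, -, rfl⟩ := Finset.mem_image.mp hk
        simp [Fin.ext_iff, Nat.mod_eq_of_lt c.2]

theorem load_le_mkspan {m K : ℕ} (I : OMSSInstance K) (τ : ℕ → Fin m) (i : Fin m) (k : Fin K) :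
    load I τ i k ≤ mkspan I τ := by
  refine le_csSup (Set.Finite.bddAbove ?_) ⟨k, i, rfl⟩
  refine (Set.finite_range fun q : Fin K × Fin m => load I τ q.2 q.1).subset ?_
  rintro x ⟨k, i, rfl⟩
  exact ⟨(k, i), rfl⟩

theorem mkspan_nonneg {m K : ℕ} (I : OMSSInstance K) (τ : ℕ → Fin m) : 0 ≤ mkspan I τ := by
  refine Real.sSup_nonneg ?_
  rintro x ⟨k, i, rfl⟩
  exact Finset.sum_nonneg fun j _ => I.hp j

theorem OPT_nonneg (m : ℕ) {K : ℕ} (I : OMSSInstance K) : 0 ≤ OPT m I := by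
  refine Real.sInf_nonneg ?_
  rintro x ⟨τ, rfl⟩
  exact mkspan_nonneg I τ

theorem OPT_le_mkspan {m K : ℕ} (I : OMSSInstance K) (τ : ℕ → Fin m) : OPT m I ≤ mkspan I τ := by
  refine csInf_le ⟨0, ?_⟩ ⟨τ, rfl⟩
  rintro x ⟨τ, rfl⟩
  exact mkspan_nonneg I τ

theorem mkspan_le_one_of_injOn {m K : ℕ} (I : OMSSInstance K) (hp : ∀ j, I.p j = 1)
    (τ : ℕ → Fin m) (hτ : ∀ k, Set.InjOn τ (I.S k)) : mkspan I τ ≤ 1 := by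
  refine Real.sSup_le ?_ zero_le_one
  rintro x ⟨k, i, rfl⟩
  simp only [load, hp, Finset.sum_const, nsmul_eq_mul, mul_one]
  norm_cast
  refine Finset.card_le_one.mpr fun a ha b hb => ?_
  simp only [Finset.mem_filter] at ha hb
  exact hτ k ha.1 hb.1 (ha.2.trans hb.2.symm)

theorem exists_hard_instance (m : ℕ) (hm : 1 ≤ m) : ∃ Km : ℕ, ∀ K : ℕ, Km ≤ K →
    ∀ A : OnlineAlg m K, ∃ I : OMSSInstance K, (∀ j, I.p j = 1) ∧ (∀ k, (I.S k).card ≤ m) ∧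
      OPT m I ≤ 1 ∧ (m : ℝ) ≤ mkspan I (algAssign A I) := by
  obtain ⟨N, hN⟩ := AdversaryWins.of_le_counts hm _ (fun _ => 0) (fun _ => Nat.zero_le _) le_rfl
  refine ⟨m * N, fun K hK A => ?_⟩
  obtain ⟨n, S, lab, h, k, c, hk⟩ := (hN (fun c r => if r = 0 then N else 0)
    (fun c => by simp)).exists_full (isPosition_initial hm A) (fun c r => by
      split_ifs with hr
      · subst hr
        exact le_card_filter_mod hm hK c
      · exact Nat.zero_le _)
  let I : OMSSInstance K := ⟨n, fun _ => 1, fun _ => zero_le_one, S, h.subset⟩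
  obtain ⟨τ, hτ, -⟩ := h.flexible (fun _ => ∅) (fun k _ => by simpa using h.card_le k)
  refine ⟨I, fun _ => rfl, h.card_le,
    (OPT_le_mkspan I τ).trans (mkspan_le_one_of_injOn I (fun _ => rfl) τ hτ), ?_⟩
  refine le_trans (le_of_eq ?_) (load_le_mkspan I (algAssign A I) c k)
  obtain ⟨hcard, hmono⟩ := h.live k c m hk
  have hfilter : (I.S k).filter (fun j => algAssign A I j = c) = S k :=
    Finset.filter_true_of_mem hmono
  simp [load, hfilter, I, hcard]

/-- **Corollary.** For every `m ≥ 1` there is a `K_m` such that for every `K ≥ K_m`, every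
deterministic online algorithm for `OMSS(m,K)` admits an instance with unit processing times
and `|S_k| ≤ m` for all scenarios on which its makespan is at least `m` times the optimum.
In particular, for every `ε > 0` there is no `(m-ε)`-competitive deterministic online
algorithm for `OMSS(m,K)` when `K ≥ K_m`, even restricted to such instances. -/
theorem omss_no_better_than_m_competitive (m : ℕ) (hm : 1 ≤ m) :
    ∃ Km : ℕ, ∀ K : ℕ, Km ≤ K →
      (∀ A : OnlineAlg m K, ∃ I : OMSSInstance K,
          (∀ j, 1 ≤ j → j ≤ I.n → I.p j = 1) ∧ (∀ k, (I.S k).card ≤ m) ∧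
          (m : ℝ) * OPT m I ≤ mkspan I (algAssign A I)) ∧
        ∀ ε : ℝ, 0 < ε →
          ¬ ∃ A : OnlineAlg m K, ∀ I : OMSSInstance K,
              (∀ j, 1 ≤ j → j ≤ I.n → I.p j = 1) → (∀ k, (I.S k).card ≤ m) →
              mkspan I (algAssign A I) ≤ ((m : ℝ) - ε) * OPT m I := by
  obtain ⟨Km, hKm⟩ := exists_hard_instance m hm
  refine ⟨Km, fun K hK => ⟨fun A => ?_, ?_⟩⟩
  · obtain ⟨I, hp, hS, hopt, hmk⟩ := hKm K hK A
    refine ⟨I, fun j _ _ => hp j, hS, le_trans ?_ hmk⟩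
    exact mul_le_of_le_one_right (Nat.cast_nonneg m) hopt
  · rintro ε hε ⟨A, hA⟩
    obtain ⟨I, hp, hS, hopt, hmk⟩ := hKm K hK A
    have h1 := hmk.trans (hA I (fun j _ _ => hp j) hS)
    have h2 := OPT_nonneg m I
    have h3 : (1 : ℝ) ≤ m := by exact_mod_cast hm
    rcases le_total 0 ((m : ℝ) - ε) with h | h
    · linarith [mul_le_of_le_one_right h hopt]
    · linarith [mul_nonpos_of_nonpos_of_nonneg h h2]
end

section
/- For every integer m ≥ 1, there exists a deterministic online algorithm A for OMSS(m,3) such that for every instance I with unit processing times (p_j = 1 for all j ∈ [n]), the makespan of A's assignment on I is at most 2·OPT(I); i.e., A is 2-competitive on the class of unit-processing-time instances of OMSS(m,3). -/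
open Finset

namespace UnitMakespan

/-- A load vector over three scenarios is balanced at level `L` if no scenario exceeds `2 * L`
and no scenario exceeds the sum of the other two by more than `L`. -/
def Balanced (L : ℕ) (v : Fin 3 → ℕ) : Prop :=
  ∀ k, v k ≤ 2 * L ∧ 2 * v k ≤ L + ∑ l, v l

lemma Balanced.mono {L L' : ℕ} (h : L ≤ L') {v : Fin 3 → ℕ} (hv : Balanced L v) :
    Balanced L' v := fun k => by
  have := hv k
  omega

/-- The load vector obtained from `v` by adding a unit job that lies in the scenarios `T`. -/
def addJob (T : Finset (Fin 3)) (v : Fin 3 → ℕ) : Fin 3 → ℕ :=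
  fun k => v k + if k ∈ T then 1 else 0

lemma balanced_addJob_of_two_le_card {L : ℕ} {v : Fin 3 → ℕ} {T : Finset (Fin 3)}
    (hT : 2 ≤ T.card) (hv : Balanced L v) (hfull : ∀ k ∈ T, v k < 2 * L) :
    Balanced L (addJob T v) := by
  have hsum : ∑ l, addJob T v l = ∑ l, v l + T.card := by
    simp [addJob, Finset.sum_add_distrib]
  intro k
  have h := hv k
  have hf := hfull k
  rw [hsum]
  unfold addJob
  split_ifs with hk
  · have := hf hk
    omega
  · omega

lemma balanced_addJob_singleton {L : ℕ} {v : Fin 3 → ℕ} {a : Fin 3}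
    (hv : Balanced L v) (ha : v a < L) : Balanced L (addJob {a} v) := by
  have hsum : ∑ l, addJob {a} v l = ∑ l, v l + 1 := by
    simp [addJob, Finset.sum_add_distrib]
  have hle : v a ≤ ∑ l, v l := Finset.single_le_sum (fun _ _ => Nat.zero_le _) (mem_univ a)
  intro k
  have h := hv k
  rw [hsum]
  unfold addJob
  split_ifs with hk
  · obtain rfl := Finset.mem_singleton.mp hk
    omega
  · omega

/-- If in every scenario containing the new job the total load stays within `m * L`, then the job
can be placed on some machine so that this machine remains balanced. -/
lemma exists_balanced_addJob {m L : ℕ} (hm : 1 ≤ m) (x : Fin m → Fin 3 → ℕ)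
    (hx : ∀ i, Balanced L (x i)) (T : Finset (Fin 3))
    (hT : ∀ k ∈ T, ∑ i, x i k + 1 ≤ m * L) :
    ∃ i, Balanced L (addJob T (x i)) := by
  have hconst (c : ℕ) : ∑ _i : Fin m, c = m * c := by simp
  rcases (show T.card = 0 ∨ T.card = 1 ∨ T.card = 2 ∨ T.card = 3 by
    have := Finset.card_le_univ T
    simp only [Fintype.card_fin] at this
    omega) with h0 | h1 | h2 | h3
  · obtain rfl := Finset.card_eq_zero.mp h0
    exact ⟨⟨0, hm⟩, by simpa [addJob, Balanced] using hx _⟩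
  · obtain ⟨a, rfl⟩ := Finset.card_eq_one.mp h1
    have ha := hT a (by simp)
    obtain ⟨i, -, hi⟩ := Finset.exists_lt_of_sum_lt (s := univ) (f := fun i => x i a)
      (g := fun _ => L) (by rw [hconst]; omega)
    exact ⟨i, balanced_addJob_singleton (hx i) hi⟩
  · obtain ⟨a, b, -, rfl⟩ := Finset.card_eq_two.mp h2
    have ha := hT a (by simp)
    have hb := hT b (by simp)
    obtain ⟨i, -, hi⟩ := Finset.exists_lt_of_sum_lt (s := univ)
      (f := fun i => x i a + x i b) (g := fun _ => 2 * L)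
      (by rw [hconst, Finset.sum_add_distrib, Nat.mul_left_comm]; omega)
    refine ⟨i, balanced_addJob_of_two_le_card h2.ge (hx i) fun k hk => ?_⟩
    rcases Finset.mem_insert.mp hk with rfl | hk
    · omega
    · obtain rfl := Finset.mem_singleton.mp hk
      omega
  · have hu : T = univ := by rw [← Finset.card_eq_iff_eq_univ]; simpa using h3
    subst hu
    have hk := fun k => hT k (mem_univ k)
    obtain ⟨i, -, hi⟩ := Finset.exists_lt_of_sum_lt (s := univ)
      (f := fun i => ∑ l, x i l) (g := fun _ => 3 * L) (by
        rw [hconst, Finset.sum_comm, Fin.sum_univ_three, Nat.mul_left_comm]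
        have := hk 0
        have := hk 1
        have := hk 2
        omega)
    refine ⟨i, balanced_addJob_of_two_le_card (by omega) (hx i) fun k _ => ?_⟩
    have := hx i k
    omega

variable {m : ℕ}

/-- The smallest `L` with `|S_k ∩ [j]| ≤ m * L` for every scenario `k`. -/
noncomputable def level (m : ℕ) (S : Fin 3 → Finset ℕ) (j : ℕ) : ℕ :=
  sInf {L | ∀ k, (S k ∩ Finset.Icc 1 j).card ≤ m * L}

lemma card_le_mul_level (hm : 1 ≤ m) (S : Fin 3 → Finset ℕ) (j : ℕ) (k : Fin 3) :
    (S k ∩ Finset.Icc 1 j).card ≤ m * level m S j := by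
  have hne : {L | ∀ k, (S k ∩ Finset.Icc 1 j).card ≤ m * L}.Nonempty := by
    refine ⟨j, fun k => ?_⟩
    calc (S k ∩ Finset.Icc 1 j).card ≤ (Finset.Icc 1 j).card :=
          Finset.card_le_card Finset.inter_subset_right
      _ = 1 * j := by simp
      _ ≤ m * j := Nat.mul_le_mul_right j hm
  exact Nat.sInf_mem hne k

lemma level_le {S : Fin 3 → Finset ℕ} {j L : ℕ}
    (h : ∀ k, (S k ∩ Finset.Icc 1 j).card ≤ m * L) : level m S j ≤ L :=
  Nat.sInf_le h

lemma level_le_succ (hm : 1 ≤ m) (S : Fin 3 → Finset ℕ) (j : ℕ) :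
    level m S j ≤ level m S (j + 1) :=
  level_le fun k => (Finset.card_le_card (Finset.inter_subset_inter_left
    (Finset.Icc_subset_Icc_right j.le_succ))).trans (card_le_mul_level hm S (j + 1) k)

/-- The scenarios containing job `j`. -/
def jobType (S : Fin 3 → Finset ℕ) (j : ℕ) : Finset (Fin 3) := univ.filter fun k => j ∈ S k

/-- A machine that remains balanced at level `L` when a job in the scenarios `T` is added to it,
if there is one. -/
noncomputable def pick [NeZero m] (x : Fin m → Fin 3 → ℕ) (L : ℕ) (T : Finset (Fin 3)) : Fin m :=
  Classical.epsilon fun i => Balanced L (addJob T (x i))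

/-- The loads of all machines after the first `j` jobs have been placed by `pick`. -/
noncomputable def loads (m : ℕ) [NeZero m] (S : Fin 3 → Finset ℕ) : ℕ → Fin m → Fin 3 → ℕ
  | 0 => fun _ _ => 0
  | j + 1 =>
    let i := pick (loads m S j) (level m S (j + 1)) (jobType S (j + 1))
    Function.update (loads m S j) i (addJob (jobType S (j + 1)) (loads m S j i))

/-- The machine on which `pick` places job `j`. -/
noncomputable def machine (m : ℕ) [NeZero m] (S : Fin 3 → Finset ℕ) (j : ℕ) : Fin m :=
  pick (loads m S (j - 1)) (level m S j) (jobType S j)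

lemma inter_Icc_inter_Icc (s : Finset ℕ) {i j : ℕ} (h : i ≤ j) :
    (s ∩ Finset.Icc 1 j) ∩ Finset.Icc 1 i = s ∩ Finset.Icc 1 i := by
  rw [Finset.inter_assoc, Finset.inter_eq_right.mpr (Finset.Icc_subset_Icc_right h)]

lemma level_inter_Icc (S : Fin 3 → Finset ℕ) {i j : ℕ} (h : i ≤ j) :
    level m (fun k => S k ∩ Finset.Icc 1 j) i = level m S i := by
  simp only [level, inter_Icc_inter_Icc _ h]

lemma jobType_inter_Icc (S : Fin 3 → Finset ℕ) {i j : ℕ} (hi : 1 ≤ i) (h : i ≤ j) :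
    jobType (fun k => S k ∩ Finset.Icc 1 j) i = jobType S i := by
  ext k
  simp [jobType, hi, h]

lemma loads_inter_Icc [NeZero m] (S : Fin 3 → Finset ℕ) {i j : ℕ} (h : i ≤ j) :
    loads m (fun k => S k ∩ Finset.Icc 1 j) i = loads m S i := by
  induction i with
  | zero => rfl
  | succ i ih =>
    simp only [loads, ih (by omega), level_inter_Icc S h, jobType_inter_Icc S i.succ_pos h]

lemma machine_inter_Icc [NeZero m] (S : Fin 3 → Finset ℕ) {j : ℕ} (hj : 1 ≤ j) :
    machine m (fun k => S k ∩ Finset.Icc 1 j) j = machine m S j := by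
  simp only [machine, loads_inter_Icc S (Nat.sub_le j 1), level_inter_Icc S le_rfl,
    jobType_inter_Icc S hj le_rfl]

lemma inter_Icc_succ (s : Finset ℕ) (j : ℕ) :
    s ∩ Finset.Icc 1 (j + 1) =
      if j + 1 ∈ s then insert (j + 1) (s ∩ Finset.Icc 1 j) else s ∩ Finset.Icc 1 j := by
  rw [← Finset.insert_Icc_right_eq_Icc_add_one (by omega)]
  split_ifs with h
  · rw [Finset.inter_insert_of_mem h]
  · rw [Finset.inter_insert_of_notMem h]

lemma loads_eq_card [NeZero m] (S : Fin 3 → Finset ℕ) (j : ℕ) (i : Fin m) (k : Fin 3) :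
    loads m S j i k = ((S k ∩ Finset.Icc 1 j).filter fun l => machine m S l = i).card := by
  induction j with
  | zero => simp [loads]
  | succ j ih =>
    have hmach : pick (loads m S j) (level m S (j + 1)) (jobType S (j + 1)) =
      machine m S (j + 1) := rfl
    simp only [loads, hmach, inter_Icc_succ]
    by_cases hi : machine m S (j + 1) = i
    · subst hi
      by_cases hk : j + 1 ∈ S k
      · simp [addJob, jobType, hk, ih, Finset.filter_insert]
      · simp [addJob, jobType, hk, ih]
    · rw [Function.update_of_ne (Ne.symm hi), ih]
      split_ifs
      · rw [Finset.filter_insert, if_neg hi]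
      · rfl

lemma sum_loads [NeZero m] (S : Fin 3 → Finset ℕ) (j : ℕ) (k : Fin 3) :
    ∑ i, loads m S j i k = (S k ∩ Finset.Icc 1 j).card := by
  simp only [loads_eq_card]
  exact (Finset.card_eq_sum_card_fiberwise fun _ _ => mem_coe.mpr (mem_univ _)).symm

lemma balanced_loads [NeZero m] (S : Fin 3 → Finset ℕ) (j : ℕ) (i : Fin m) :
    Balanced (level m S j) (loads m S j i) := by
  have hm : 1 ≤ m := NeZero.one_le
  induction j generalizing i with
  | zero => simp [Balanced, loads]
  | succ j ih =>
    have hbal := fun i => (ih i).mono (level_le_succ hm S j)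
    have hex := exists_balanced_addJob hm (loads m S j) hbal (jobType S (j + 1)) fun k hk => by
      have hmem : j + 1 ∈ S k := by simpa [jobType] using hk
      have hcard := card_le_mul_level hm S (j + 1) k
      rw [inter_Icc_succ, if_pos hmem, Finset.card_insert_of_notMem (by simp)] at hcard
      rwa [sum_loads]
    simp only [loads]
    rw [Function.update_apply]
    split_ifs
    · exact Classical.epsilon_spec hex
    · exact hbal i

lemma load_eq_card {K : ℕ} {I : OMSSInstance K} (hI : ∀ j, 1 ≤ j → j ≤ I.n → I.p j = 1)
    (τ : ℕ → Fin m) (i : Fin m) (k : Fin K) :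
    load I τ i k = ((I.S k).filter fun j => τ j = i).card := by
  rw [load, Finset.cast_card]
  refine Finset.sum_congr rfl fun j hj => ?_
  have := Finset.mem_Icc.mp (I.hS k (Finset.mem_filter.mp hj).1)
  exact hI j this.1 this.2

lemma load_le_mkspan {K : ℕ} (I : OMSSInstance K) (τ : ℕ → Fin m) (i : Fin m) (k : Fin K) :
    load I τ i k ≤ mkspan I τ := by
  refine le_csSup (Set.Finite.bddAbove ?_) ⟨k, i, rfl⟩
  refine (Set.finite_range fun q : Fin K × Fin m => load I τ q.2 q.1).subset ?_
  rintro x ⟨k, i, rfl⟩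
  exact ⟨(k, i), rfl⟩

lemma level_le_mkspan (hm : 1 ≤ m) {I : OMSSInstance 3}
    (hI : ∀ j, 1 ≤ j → j ≤ I.n → I.p j = 1) (τ : ℕ → Fin m) :
    (level m I.S I.n : ℝ) ≤ mkspan I τ := by
  have hnonneg : 0 ≤ mkspan I τ :=
    (Finset.sum_nonneg fun j _ => I.hp j).trans (load_le_mkspan I τ ⟨0, hm⟩ 0)
  refine (Nat.le_floor_iff hnonneg).mp (level_le fun k => ?_)
  rw [Finset.inter_eq_left.mpr (I.hS k), Finset.card_eq_sum_card_fiberwise (f := τ) (t := univ)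
    fun _ _ => mem_coe.mpr (mem_univ _)]
  refine (Finset.sum_le_card_nsmul univ _ ⌊mkspan I τ⌋₊ fun i _ => ?_).trans (by simp)
  exact Nat.le_floor ((load_eq_card hI τ i k).symm.le.trans (load_le_mkspan I τ i k))

lemma level_le_OPT (hm : 1 ≤ m) {I : OMSSInstance 3}
    (hI : ∀ j, 1 ≤ j → j ≤ I.n → I.p j = 1) : (level m I.S I.n : ℝ) ≤ OPT m I := by
  refine le_csInf ⟨_, fun _ => ⟨0, hm⟩, rfl⟩ ?_
  rintro x ⟨τ, rfl⟩
  exact level_le_mkspan hm hI τ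

end UnitMakespan

/-- **Theorem (bingo card algorithm).** For every `m ≥ 1` there is a deterministic online
algorithm for `OMSS(m,3)` whose makespan is at most twice the optimum on every instance with
unit processing times, i.e. a `2`-competitive algorithm on the class of unit-processing-time
instances of `OMSS(m,3)`. -/
theorem exists_two_competitive_unit_algorithm (m : ℕ) (hm : 1 ≤ m) :
    ∃ A : OnlineAlg m 3, ∀ I : OMSSInstance 3,
      (∀ j, 1 ≤ j → j ≤ I.n → I.p j = 1) →
      mkspan I (algAssign A I) ≤ 2 * OPT m I := by
  have : NeZero m := ⟨by omega⟩
  refine ⟨fun j _ S => UnitMakespan.machine m S j, fun I hI => ?_⟩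
  refine csSup_le ⟨_, 0, ⟨0, hm⟩, rfl⟩ ?_
  rintro x ⟨k, i, rfl⟩
  have hload := (UnitMakespan.balanced_loads I.S I.n i k).1
  rw [UnitMakespan.loads_eq_card, Finset.inter_eq_left.mpr (I.hS k)] at hload
  have hassign : ((I.S k).filter fun j =>
      algAssign (fun j _ S => UnitMakespan.machine m S j) I j = i) =
      (I.S k).filter fun j => UnitMakespan.machine m I.S j = i := by
    refine Finset.filter_congr fun j hj => ?_
    rw [algAssign, UnitMakespan.machine_inter_Icc I.S (Finset.mem_Icc.mp (I.hS k hj)).1]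
  rw [UnitMakespan.load_eq_card hI, hassign]
  calc _ ≤ ((2 * UnitMakespan.level m I.S I.n : ℕ) : ℝ) := by exact_mod_cast hload
    _ ≤ 2 * OPT m I := by
      push_cast
      linarith [UnitMakespan.level_le_OPT hm hI]
end
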